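/- The language classes of reversible two-party Watson-Crick systems with communication bounds O(1), O(log n), O(√n), and O(n) form a strictly increasing hierarchy: L(REV-PWK(O(1))) ⊊ L(REV-PWK(O(log n))) ⊊ L(REV-PWK(O(√n))) ⊊ L(REV-PWK(O(n))). -/

import Mathlib

namespace WK

/-- Tape symbols: input symbols plus the two endmarkers.
`Sum.inr false` is the left endmarker, `Sum.inr true` the right endmarker. -/
abbrev TSym (α : Type) : Type := α ⊕ Bool

/-- The tape for input `w`: left endmarker, the symbols of `w`, right endmarker. -/
def tape {α : Type} (w : List α) (k : ℕ) : TSym α :=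
  ((Sum.inr false :: w.map Sum.inl) ++ [Sum.inr true]).getD k (Sum.inr true)

/-- A deterministic two-party Watson-Crick system: two finite automata (the upper
component `1` and the lower component `2`) with a finite set `M` of messages,
partial transition functions `δᵢ` (depending on state, scanned symbol and received
message, `none` = no message) and broadcast functions `μᵢ`. -/
structure DPWK (α : Type) where
  M : Type
  Q1 : Type
  Q2 : Type
  fM : Fintype M
  fQ1 : Fintype Q1
  fQ2 : Fintype Q2
  δ1 : Q1 → TSym α → Option M → Option (Q1 × Bool)
  δ2 : Q2 → TSym α → Option M → Option (Q2 × Bool)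
  μ1 : Q1 → TSym α → Option M
  μ2 : Q2 → TSym α → Option M
  q01 : Q1
  q02 : Q2
  F1 : Set Q1
  F2 : Set Q2

/-- A configuration: states and head positions of the two components. -/
structure Config {α : Type} (A : DPWK α) where
  p : A.Q1
  i : ℕ
  q : A.Q2
  j : ℕ

/-- One synchronous (forward) computation step: each component reads its symbol,
receives the message broadcast by the other component, changes its state and
optionally moves (the upper head to the right, the lower head to the left). -/
def Step {α : Type} (A : DPWK α) (w : List α) (c c' : Config A) : Prop :=
  ∃ d1 d2 : Bool,
    A.δ1 c.p (tape w c.i) (A.μ2 c.q (tape w c.j)) = some (c'.p, d1) ∧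
    A.δ2 c.q (tape w c.j) (A.μ1 c.p (tape w c.i)) = some (c'.q, d2) ∧
    c'.i = c.i + (cond d1 1 0) ∧ c.j = c'.j + (cond d2 1 0)

/-- The initial configuration on input `w`: the upper component on the left
endmarker, the lower component on the right endmarker. -/
def initConf {α : Type} (A : DPWK α) (w : List α) : Config A :=
  ⟨A.q01, 0, A.q02, w.length + 1⟩

/-- The system halts in `c` if no successor configuration exists. -/
def Halted {α : Type} (A : DPWK α) (w : List α) (c : Config A) : Prop :=
  ¬ ∃ c', Step A w c c'

/-- A configuration is accepting if at least one component is in an accepting state. -/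
def AccConf {α : Type} (A : DPWK α) (c : Config A) : Prop :=
  c.p ∈ A.F1 ∨ c.q ∈ A.F2

/-- `cs` is an accepting computation of `A` on `w`: it starts in the initial
configuration, follows the step relation, and ends in a halting configuration
with at least one component in an accepting state. -/
def AccComp {α : Type} (A : DPWK α) (w : List α) (cs : List (Config A)) : Prop :=
  cs.head? = some (initConf A w) ∧ List.Chain' (Step A w) cs ∧
    ∃ c, cs.getLast? = some c ∧ Halted A w c ∧ AccConf A c

def Accepts {α : Type} (A : DPWK α) (w : List α) : Prop := ∃ cs, AccComp A w cs

/-- The language accepted by `A`. -/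
def lang {α : Type} (A : DPWK α) : Set (List α) := { w | Accepts A w }

/-- One backward computation step, induced by reverse transition functions `δ'ᵢ` and
reverse broadcast functions `μ'ᵢ`: the heads first move to their predecessor
positions (the upper head left, the lower head right) and then read the symbols there. -/
def BackStep {α : Type} (A : DPWK α)
    (δ'1 : A.Q1 → TSym α → Option A.M → Option (A.Q1 × Bool))
    (δ'2 : A.Q2 → TSym α → Option A.M → Option (A.Q2 × Bool))
    (μ'1 : A.Q1 → TSym α → Option A.M)
    (μ'2 : A.Q2 → TSym α → Option A.M)
    (w : List α) (c' c : Config A) : Prop :=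
  ∃ d1 d2 : Bool,
    δ'1 c'.p (tape w c.i) (μ'2 c'.q (tape w c.j)) = some (c.p, d1) ∧
    δ'2 c'.q (tape w c.j) (μ'1 c'.p (tape w c.i)) = some (c.q, d2) ∧
    c'.i = c.i + (cond d1 1 0) ∧ c.j = c'.j + (cond d2 1 0)

/-- A witness of reversibility: reverse transition and broadcast functions whose
induced backward step relation is exactly the inverse of the forward step relation,
so every configuration has at most one predecessor, computable by such a system. -/
structure RevWitness {α : Type} (A : DPWK α) where
  δ'1 : A.Q1 → TSym α → Option A.M → Option (A.Q1 × Bool)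
  δ'2 : A.Q2 → TSym α → Option A.M → Option (A.Q2 × Bool)
  μ'1 : A.Q1 → TSym α → Option A.M
  μ'2 : A.Q2 → TSym α → Option A.M
  inverse : ∀ (w : List α) (c c' : Config A),
    BackStep A δ'1 δ'2 μ'1 μ'2 w c' c ↔ Step A w c c'

/-- A reversible deterministic two-party Watson-Crick system (REV-PWK). -/
def Reversible {α : Type} (A : DPWK α) : Prop := Nonempty (RevWitness A)

/-- Number of messages (`0`, `1` or `2`) broadcast in one step from configuration `c`,
with respect to broadcast functions `μ1`, `μ2`. -/
def stepMsgs {α : Type} (A : DPWK α)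
    (μ1 : A.Q1 → TSym α → Option A.M) (μ2 : A.Q2 → TSym α → Option A.M)
    (w : List α) (c : Config A) : ℕ :=
  ((μ1 c.p (tape w c.i)).elim 0 fun _ => 1) + ((μ2 c.q (tape w c.j)).elim 0 fun _ => 1)

/-- Total number of messages sent during the computation `cs` (no messages are
sent from the final, halting configuration). -/
def commCount {α : Type} (A : DPWK α)
    (μ1 : A.Q1 → TSym α → Option A.M) (μ2 : A.Q2 → TSym α → Option A.M)
    (w : List α) (cs : List (Config A)) : ℕ :=
  (cs.dropLast.map (stepMsgs A μ1 μ2 w)).sum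

/-- `A` is a reversible system that is communication bounded by `f`: it is reversible
and every word of its language is accepted by a computation in which the number of
messages sent in the forward computation and in the reverse computation are each at
most `f` of the input length. -/
def RevCommBounded {α : Type} (A : DPWK α) (f : ℕ → ℕ) : Prop :=
  ∃ Wit : RevWitness A, ∀ w ∈ lang A, ∃ cs, AccComp A w cs ∧
    commCount A A.μ1 A.μ2 w cs ≤ f w.length ∧
    commCount A Wit.μ'1 Wit.μ'2 w cs.reverse ≤ f w.length

/-- `A` (not necessarily reversible) is communication bounded by `f`. -/
def CommBounded {α : Type} (A : DPWK α) (f : ℕ → ℕ) : Prop :=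
  ∀ w ∈ lang A, ∃ cs, AccComp A w cs ∧ commCount A A.μ1 A.μ2 w cs ≤ f w.length

/-- The family of languages accepted by reversible deterministic two-party
Watson-Crick systems over the alphabet `α`. -/
def RevPWKLangs (α : Type) : Set (Set (List α)) :=
  { L | ∃ A : DPWK α, Reversible A ∧ lang A = L }

/-- Languages accepted by REV-PWKs with `O(f)` communication. -/
def RevPWKLangsO (α : Type) (f : ℕ → ℕ) : Set (Set (List α)) :=
  { L | ∃ (A : DPWK α) (C : ℕ),
      RevCommBounded A (fun n => C * f n + C) ∧ lang A = L }

/-- Languages accepted by (possibly irreversible) DPWKs with `O(f)` communication. -/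
def PWKLangsO (α : Type) (f : ℕ → ℕ) : Set (Set (List α)) :=
  { L | ∃ (A : DPWK α) (C : ℕ),
      CommBounded A (fun n => C * f n + C) ∧ lang A = L }

end WK

namespace WK

section Generic
variable {α : Type} {A : DPWK α} {w : List α}

theorem step_det {c d e : Config A} (h1 : Step A w c d) (h2 : Step A w c e) : d = e := by
  obtain ⟨a1, a2, h3, h4, h5, h6⟩ := h1
  obtain ⟨b1, b2, k3, k4, k5, k6⟩ := h2
  rw [h3] at k3
  rw [h4] at k4
  simp only [Option.some.injEq, Prod.mk.injEq] at k3 k4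
  obtain ⟨k3, rfl⟩ := k3
  obtain ⟨k4, rfl⟩ := k4
  cases d; cases e
  simp_all

/-- Acceptance starting from configuration `c`. -/
def AccFrom (A : DPWK α) (w : List α) (c : Config A) : Prop :=
  ∃ c', Relation.ReflTransGen (Step A w) c c' ∧ Halted A w c' ∧ AccConf A c'

theorem accFrom_step {c d : Config A} (h : Step A w c d) : AccFrom A w c ↔ AccFrom A w d := by
  constructor
  · rintro ⟨c', hr, hh, ha⟩
    rcases Relation.ReflTransGen.cases_head hr with rfl | ⟨e, he, hr'⟩
    · exact absurd ⟨d, h⟩ hh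
    · rw [step_det h he]
      exact ⟨c', hr', hh, ha⟩
  · rintro ⟨c', hr, hh, ha⟩
    exact ⟨c', hr.head h, hh, ha⟩

theorem accFrom_halted {c : Config A} (h : Halted A w c) : AccFrom A w c ↔ AccConf A c := by
  constructor
  · rintro ⟨c', hr, hh, ha⟩
    rcases Relation.ReflTransGen.cases_head hr with rfl | ⟨e, he, hr'⟩
    · exact ha
    · exact absurd ⟨e, he⟩ h
  · intro ha
    exact ⟨c, .refl, h, ha⟩

theorem accepts_iff : Accepts A w ↔ AccFrom A w (initConf A w) := by
  constructor
  · rintro ⟨cs, h1, h2, c, h3, h4, h5⟩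
    have hne : cs ≠ [] := by rintro rfl; simp at h1
    have := List.relationReflTransGen_of_exists_isChain cs h2 hne
    rw [List.head?_eq_some_head hne, Option.some.injEq] at h1
    rw [List.getLast?_eq_some_getLast hne, Option.some.injEq] at h3
    rw [h1, h3] at this
    exact ⟨c, this, h4, h5⟩
  · rintro ⟨c, hr, h4, h5⟩
    obtain ⟨l, hne, hc, hh, hl⟩ := List.exists_isChain_ne_nil_of_relationReflTransGen hr
    refine ⟨l, ?_, hc, c, ?_, h4, h5⟩
    · rw [List.head?_eq_some_head hne, hh]
    · rw [List.getLast?_eq_some_getLast hne, hl]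

theorem tape_zero : tape w 0 = Sum.inr false := by simp [tape]

theorem tape_succ_lt {i : ℕ} (h : i < w.length) : tape w (i + 1) = Sum.inl w[i] := by
  simp [tape, List.getD, List.getElem?_append, h]

theorem tape_succ_ge {i : ℕ} (h : w.length ≤ i) : tape w (i + 1) = Sum.inr true := by
  simp only [tape, List.getD]
  rw [List.cons_append, List.getElem?_cons_succ, List.getElem?_append_right (by simpa using h)]
  rcases Nat.eq_zero_or_pos (i - (w.map (Sum.inl : α → α ⊕ Bool)).length) with h0 | h0
  · rw [h0]; simp
  · rw [List.getElem?_eq_none (by simp only [List.length_singleton]; exact h0)]; simp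

end Generic

/-! ### The witness machines -/

/-- Modes: `pal` (linear), `lg` (logarithmic), `sq` (square root). -/
inductive Mode | pal | lg | sq
  deriving DecidableEq

/-- Decoded letters. -/
inductive Lt | a | b | d | c | o
  deriving DecidableEq

inductive S1 | s1 | wt | s2 | s3 | fin
  deriving DecidableEq

inductive S2 | s1 | t0 | t1 | fin
  deriving DecidableEq

inductive Ms | b1 | d1 | c1 | b2 | e
  deriving DecidableEq

instance : Fintype S1 := ⟨{.s1, .wt, .s2, .s3, .fin}, by intro x; cases x <;> decide⟩

instance : Fintype S2 := ⟨{.s1, .t0, .t1, .fin}, by intro x; cases x <;> decide⟩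

instance : Fintype Ms := ⟨{.b1, .d1, .c1, .b2, .e}, by intro x; cases x <;> decide⟩

def dec (x : Fin 5) : Lt :=
  if x = 0 then .a else if x = 1 then .b else if x = 2 then .d else if x = 3 then .c else .o

def enc : Lt → Fin 5
  | .a => 0
  | .b => 1
  | .d => 2
  | .c => 3
  | .o => 4

theorem dec_enc (x : Lt) : dec (enc x) = x := by cases x <;> decide

def D1 (m : Mode) : S1 → Lt → Option Ms → Option (S1 × Bool)
  | .s1, .a, none => some (.s1, true)
  | .s1, .b, some .b1 => some (.s1, true)
  | .s1, .d, some .d1 => some (.s1, true)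
  | .s1, .c, some .c1 => if m = .pal then some (.fin, false) else some (.wt, false)
  | .wt, .c, none => some (.wt, false)
  | .wt, .c, some .b2 => some (.s2, true)
  | .s2, .b, some .b2 => some (.s2, true)
  | .s2, .b, some .e => some (.fin, false)
  | .s2, .a, none => if m = .lg then some (.s3, false) else some (.s2, true)
  | .s3, .a, none => if m = .lg then some (.s2, true) else none
  | .s2, .d, none => some (.s3, false)
  | .s3, .d, none => some (.s2, true)
  | _, _, _ => none

def D2 : S2 → Lt → Option S2
  | .s1, .a => some .s1
  | .s1, .b => some .s1
  | .s1, .d => some .s1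
  | .s1, .c => some .t0
  | .t0, .a => some .t0
  | .t0, .d => some .t1
  | .t1, .a => some .t1
  | .t1, .b => some .t0
  | _, _ => none

def out : S2 → Lt → Option Ms
  | .s1, .b => some .b1
  | .s1, .d => some .d1
  | .s1, .c => some .c1
  | .t1, .b => some .b2
  | _, _ => none

def del1 (m : Mode) (p : S1) (x : TSym (Fin 5)) (ms : Option Ms) : Option (S1 × Bool) :=
  match x with
  | .inl y => D1 m p (dec y) ms
  | .inr false => if p = .s1 ∧ ms = none then some (.s1, true) else none
  | .inr true => none

def del2 (q : S2) (x : TSym (Fin 5)) : Option (S2 × Bool) :=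
  match x with
  | .inl y => (D2 q (dec y)).map fun q' => (q', true)
  | .inr false => if q = .t1 then some (.fin, false) else none
  | .inr true => if q = .s1 then some (.s1, true) else none

def mu2 (q : S2) (x : TSym (Fin 5)) : Option Ms :=
  match x with
  | .inl y => out q (dec y)
  | .inr false => if q = .t1 then some .e else none
  | .inr true => none

/-- The witness machine. -/
def mach (m : Mode) : DPWK (Fin 5) where
  M := Ms
  Q1 := S1
  Q2 := S2
  fM := inferInstance
  fQ1 := inferInstance
  fQ2 := inferInstance
  δ1 := del1 m
  δ2 := fun q x _ => del2 q x
  μ1 := fun _ _ => none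
  μ2 := mu2
  q01 := .s1
  q02 := .s1
  F1 := {.fin}
  F2 := ∅

theorem D1_inj (m : Mode) (p p' : S1) (x : Lt) (ms : Option Ms) (r : S1) (k k' : Bool)
    (h : D1 m p x ms = some (r, k)) (h' : D1 m p' x ms = some (r, k')) : p = p' := by
  revert h h'
  rcases ms with _ | ms
  · cases m <;> cases x <;> cases p <;> cases p' <;> simp +decide [D1] <;>
      (cases r <;> simp)
  · cases m <;> cases x <;> cases ms <;> cases p <;> cases p' <;>
      simp +decide [D1] <;>
      (cases r <;> simp)

theorem D2_inj (q q' : S2) (x : Lt) (r : S2)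
    (h : D2 q x = some r) (h' : D2 q' x = some r) : q = q' := by
  revert h h'
  cases x <;> cases q <;> cases q' <;> simp [D2] <;>
      (cases r <;> simp)

theorem del1_inj (m : Mode) (p p' : S1) (x : TSym (Fin 5)) (ms : Option Ms) (r : S1) (k k' : Bool)
    (h : del1 m p x ms = some (r, k)) (h' : del1 m p' x ms = some (r, k')) : p = p' := by
  rcases x with x | _ | _
  · exact D1_inj m p p' (dec x) ms r k k' h h'
  · simp only [del1] at h h'
    split_ifs at h h' with h1 h2
    rw [h1.1, h2.1]
  · simp [del1] at h

theorem del2_inj (q q' : S2) (x : TSym (Fin 5)) (r : S2) (k k' : Bool)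
    (h : del2 q x = some (r, k)) (h' : del2 q' x = some (r, k')) : q = q' := by
  rcases x with x | _ | _
  · simp only [del2, Option.map_eq_some_iff, Prod.mk.injEq] at h h'
    obtain ⟨a, h1, rfl, -⟩ := h
    obtain ⟨a, h2, rfl, -⟩ := h'
    exact D2_inj q q' (dec x) _ h1 h2
  · simp only [del2] at h h'
    split_ifs at h h' with h1 h2
    rw [h1, h2]
  · simp only [del2] at h h'
    split_ifs at h h' with h1 h2
    rw [h1, h2]

open Classical in
noncomputable def rd1 (m : Mode) (r : S1) (x : TSym (Fin 5)) (ms : Option Ms) :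
    Option (S1 × Bool) :=
  if h : ∃ z : S1 × Bool, del1 m z.1 x ms = some (r, z.2) then some h.choose else none

open Classical in
noncomputable def rd2 (r : S2) (x : TSym (Fin 5)) : Option (S2 × Bool) :=
  if h : ∃ z : S2 × Bool, del2 z.1 x = some (r, z.2) then some h.choose else none

theorem rd1_iff (m : Mode) (r p : S1) (x : TSym (Fin 5)) (ms : Option Ms) (k : Bool) :
    rd1 m r x ms = some (p, k) ↔ del1 m p x ms = some (r, k) := by
  unfold rd1
  split_ifs with h
  · constructor
    · intro h1
      have := h.choose_spec
      simp only [Option.some.injEq] at h1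
      rwa [h1] at this
    · intro h1
      have h2 := h.choose_spec
      have h3 := del1_inj m _ _ _ _ _ _ _ h1 h2
      rw [← h3, h1] at h2
      simp only [Option.some.injEq, Prod.mk.injEq, true_and] at h2
      rw [h2, h3]
  · simp only [false_iff, reduceCtorEq]
    intro h1
    exact h ⟨(p, k), h1⟩

theorem rd2_iff (r q : S2) (x : TSym (Fin 5)) (k : Bool) :
    rd2 r x = some (q, k) ↔ del2 q x = some (r, k) := by
  unfold rd2
  split_ifs with h
  · constructor
    · intro h1
      have := h.choose_spec
      simp only [Option.some.injEq] at h1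
      rwa [h1] at this
    · intro h1
      have h2 := h.choose_spec
      have h3 := del2_inj _ _ _ _ _ _ h1 h2
      rw [← h3, h1] at h2
      simp only [Option.some.injEq, Prod.mk.injEq, true_and] at h2
      rw [h2, h3]
  · simp only [false_iff, reduceCtorEq]
    intro h1
    exact h ⟨(q, k), h1⟩

noncomputable def rmu2 (r : S2) (x : TSym (Fin 5)) : Option Ms :=
  (rd2 r x).bind fun z => mu2 z.1 x

noncomputable def wit (m : Mode) : RevWitness (mach m) where
  δ'1 := rd1 m
  δ'2 := fun q x _ => rd2 q x
  μ'1 := fun _ _ => none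
  μ'2 := rmu2
  inverse := by
    intro w c c'
    unfold BackStep Step
    refine exists_congr fun d1 => exists_congr fun d2 => ?_
    have key : del2 c.q (tape w c.j) = some (c'.q, d2) →
        rmu2 c'.q (tape w c.j) = mu2 c.q (tape w c.j) := by
      intro h
      unfold rmu2
      rw [(rd2_iff _ _ _ _).2 h]
      rfl
    constructor
    · rintro ⟨h1, h2, h3, h4⟩
      have h2' := (rd2_iff _ _ _ _).1 h2
      refine ⟨?_, h2', h3, h4⟩
      rw [key h2'] at h1
      exact (rd1_iff _ _ _ _ _ _).1 h1
    · rintro ⟨h1, h2, h3, h4⟩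
      refine ⟨?_, (rd2_iff _ _ _ _).2 h2, h3, h4⟩
      rw [key h2]
      exact (rd1_iff _ _ _ _ _ _).2 h1

/-- Loud tape symbols. -/
def loud (x : TSym (Fin 5)) : ℕ := if x = Sum.inl 0 then 0 else 1

theorem mu2_loud (q : S2) (x : TSym (Fin 5)) : ((mu2 q x).elim 0 fun _ => 1) ≤ loud x := by
  unfold loud
  split_ifs with h
  · subst h
    cases q <;> simp [mu2, dec, out]
  · cases mu2 q x <;> simp

theorem rmu2_loud (q : S2) (x : TSym (Fin 5)) : ((rmu2 q x).elim 0 fun _ => 1) ≤ loud x := by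
  unfold rmu2
  cases h : rd2 q x with
  | none => simp
  | some z => exact mu2_loud z.1 x

theorem del2_move (q r : S2) (x : TSym (Fin 5)) (k : Bool) (h : del2 q x = some (r, k)) :
    k = true ∨ (r = .fin ∧ k = false) := by
  rcases x with x | _ | _
  · simp only [del2, Option.map_eq_some_iff, Prod.mk.injEq] at h
    obtain ⟨a, -, -, rfl⟩ := h
    exact Or.inl rfl
  · simp only [del2] at h
    split_ifs at h with h5
    simp only [Option.some.injEq, Prod.mk.injEq] at h
    exact Or.inr ⟨h.1.symm, h.2.symm⟩
  · simp only [del2] at h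
    split_ifs at h with h5
    simp only [Option.some.injEq, Prod.mk.injEq] at h
    exact Or.inl h.2.symm

theorem del2_fin (x : TSym (Fin 5)) : del2 .fin x = none := by
  rcases x with x | _ | _
  · cases hd : dec x <;> simp [del2, D2, hd]
  · simp [del2]
  · simp [del2]

theorem step_j (m : Mode) (w : List (Fin 5)) (c c' : Config (mach m)) (h : Step (mach m) w c c') :
    c.j = c'.j + 1 ∨ (c'.q = S2.fin ∧ c.j = c'.j) := by
  obtain ⟨d1, d2, h1, h2, h3, h4⟩ := h
  rcases del2_move _ _ _ _ h2 with rfl | ⟨h, rfl⟩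
  · left; simpa using h4
  · right; exact ⟨h, by simpa using h4⟩

theorem fin_halted (m : Mode) (w : List (Fin 5)) (c c' : Config (mach m)) (h : c.q = S2.fin) :
    ¬ Step (mach m) w c c' := by
  rintro ⟨d1, d2, h1, h2, h3, h4⟩
  have h5 : del2 c.q (tape w c.j) = some (c'.q, d2) := h2
  rw [h, del2_fin] at h5
  exact absurd h5 (by simp)

theorem loud_le_one (x) : loud x ≤ 1 := by unfold loud; split_ifs <;> simp

theorem chain_loud (m : Mode) (w : List (Fin 5)) (cs : List (Config (mach m))) :
    ∀ c, List.IsChain (Step (mach m) w) (c :: cs) →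
    ((c :: cs).map fun c => loud (tape w c.j)).sum ≤
      (∑ k ∈ Finset.range (c.j + 1), loud (tape w k)) + 1 := by
  induction cs with
  | nil =>
    intro c _
    simp [Finset.sum_range_succ]
    omega
  | cons e cs ih =>
    intro c h
    rw [List.isChain_cons_cons] at h
    obtain ⟨h1, h2⟩ := h
    have := ih e h2
    rw [List.map_cons, List.sum_cons]
    rcases step_j m w c e h1 with h3 | ⟨h3, h4⟩
    · rw [Finset.sum_range_succ, h3]
      rw [h3] at *
      omega
    · cases cs with
      | nil =>
        simp only [List.map_cons, List.map_nil, List.sum_cons, List.sum_nil]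
        have h5 := loud_le_one (tape w e.j)
        rw [Finset.sum_range_succ, h4]
        omega
      | cons x xs =>
        rw [List.isChain_cons_cons] at h2
        exact absurd h2.1 (fin_halted m w e x h3)

theorem sum_loud (w : List (Fin 5)) :
    ∑ k ∈ Finset.range (w.length + 2), loud (tape w k) ≤
      (w.map fun x => if dec x = .a then 0 else 1).sum + 2 := by
  rw [Finset.sum_range_succ, Finset.sum_range_succ']
  have h1 := loud_le_one (tape w 0)
  have h2 := loud_le_one (tape w (w.length + 1))
  have h3 : ∑ k ∈ Finset.range w.length, loud (tape w (k + 1)) ≤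
      (w.map fun x => if dec x = .a then 0 else 1).sum := by
    rw [Finset.sum_range]
    rw [← List.sum_ofFn]
    apply le_of_eq
    congr 1
    apply List.ext_getElem
    · simp
    · intro n h h'
      simp only [List.getElem_ofFn, List.getElem_map]
      rw [tape_succ_lt (by simpa using h')]
      generalize w[n]'_ = y
      revert y
      unfold loud
      simp only [Sum.inl.injEq]
      decide
  omega

theorem list_sum_le {β : Type} (l : List β) (f g : β → ℕ) (h : ∀ x, f x ≤ g x) :
    (l.map f).sum ≤ (l.map g).sum := by
  induction l with
  | nil => simp
  | cons x l ih => simp only [List.map_cons, List.sum_cons]; have := h x; omega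

theorem list_dropLast_sum_le {β : Type} (l : List β) (f : β → ℕ) :
    (l.dropLast.map f).sum ≤ (l.map f).sum := by
  have : List.Sublist (l.dropLast.map f) (l.map f) := (List.dropLast_sublist l).map f
  exact this.sum_le_sum (by simp)

/-- number of non-`a` letters -/
def nonA (l : List Lt) : ℕ := (l.map fun x => if x = .a then 0 else 1).sum

theorem mach_bounded (m : Mode) (f : ℕ → ℕ)
    (h : ∀ w ∈ lang (mach m), nonA (w.map dec) + 3 ≤ f w.length) : RevCommBounded (mach m) f := by
  refine ⟨wit m, fun w hw => ?_⟩
  have hw0 := h w hw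
  obtain ⟨cs, h1, h2, h3⟩ := hw
  have hs : (cs.map fun c => loud (tape w c.j)).sum ≤ f w.length := by
    refine le_trans ?_ hw0
    rcases cs with _ | ⟨c, cs⟩
    · simp
    · have h4 := chain_loud m w cs c h2
      simp only [List.head?_cons, Option.some.injEq] at h1
      have h5 : c.j = w.length + 1 := by rw [h1]; rfl
      rw [h5] at h4
      have h6 := sum_loud w
      unfold nonA
      rw [List.map_map]
      change _ ≤ (w.map fun x => if dec x = .a then 0 else 1).sum + 3
      exact h4.trans (Nat.add_le_add_right h6 1)
  refine ⟨cs, ⟨h1, h2, h3⟩, le_trans ?_ hs, le_trans ?_ hs⟩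
  · refine (list_dropLast_sum_le _ _).trans (list_sum_le _ _ _ fun c => ?_)
    unfold stepMsgs
    change 0 + _ ≤ _
    rw [Nat.zero_add]
    exact mu2_loud c.q _
  · refine (list_dropLast_sum_le _ _).trans ?_
    have hrev : (cs.reverse.map (stepMsgs (mach m) (wit m).μ'1 (wit m).μ'2 w)).sum =
      (cs.map (stepMsgs (mach m) (wit m).μ'1 (wit m).μ'2 w)).sum := by
      rw [List.map_reverse, List.sum_reverse]
    rw [hrev]
    refine list_sum_le _ _ _ fun c => ?_
    unfold stepMsgs
    change 0 + _ ≤ _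
    rw [Nat.zero_add]
    exact rmu2_loud c.q _

end WK

namespace WK

/-- Abstract run of the witness machine on letter lists. -/
def run (m : Mode) : List Lt → S1 → List Lt → S2 → Prop
  | [], p, l1, q => p = .fin ∨ (p = .s2 ∧ q = .t1 ∧ l1.head? = some .b)
  | _ :: _, p, [], _ => p = .fin
  | y :: l2, p, x :: l1, q =>
    match D1 m p x (out q y), D2 q y with
    | some (p', true), some q' => run m l2 p' l1 q'
    | some (p', false), some q' => run m l2 p' (x :: l1) q'
    | _, _ => p = .fin

theorem mk_step {m : Mode} {w : List (Fin 5)} {p p' : S1} {q q' : S2} {i i' j j' : ℕ} (d1 d2 : Bool)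
    (h1 : del1 m p (tape w i) (mu2 q (tape w j)) = some (p', d1))
    (h2 : del2 q (tape w j) = some (q', d2))
    (h3 : i' = i + cond d1 1 0) (h4 : j = j' + cond d2 1 0) :
    Step (mach m) w ⟨p, i, q, j⟩ ⟨p', i', q', j'⟩ := ⟨d1, d2, h1, h2, h3, h4⟩

theorem mk_halted1 {m : Mode} {w : List (Fin 5)} {p : S1} {q : S2} {i j : ℕ}
    (h1 : del1 m p (tape w i) (mu2 q (tape w j)) = none) :
    AccFrom (mach m) w ⟨p, i, q, j⟩ ↔ p = .fin := by
  rw [accFrom_halted]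
  · constructor
    · rintro (h | h)
      · exact h
      · exact absurd h (Set.notMem_empty _)
    · intro h
      exact Or.inl h
  · rintro ⟨c, d1, d2, h, -⟩
    have h' : del1 m p (tape w i) (mu2 q (tape w j)) = some (c.p, d1) := h
    rw [h1] at h'
    cases h'

theorem mk_halted2 {m : Mode} {w : List (Fin 5)} {p : S1} {q : S2} {i j : ℕ}
    (h1 : del2 q (tape w j) = none) :
    AccFrom (mach m) w ⟨p, i, q, j⟩ ↔ p = .fin := by
  rw [accFrom_halted]
  · constructor
    · rintro (h | h)
      · exact h
      · exact absurd h (Set.notMem_empty _)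
    · intro h
      exact Or.inl h
  · rintro ⟨c, d1, d2, -, h, -⟩
    have h' : del2 q (tape w j) = some (c.q, d2) := h
    rw [h1] at h'
    cases h'

theorem D1_e (m : Mode) (p : S1) (x : Lt) :
    D1 m p x (some .e) = if p = .s2 ∧ x = .b then some (.fin, false) else none := by
  cases p <;> cases x <;> simp [D1]

theorem sim (m : Mode) (w : List (Fin 5)) (j : ℕ) : ∀ (_ : j ≤ w.length) (p : S1) (i : ℕ) (q : S2),
    AccFrom (mach m) w ⟨p, i + 1, q, j⟩ ↔
      run m ((w.take j).reverse.map dec) p ((w.drop i).map dec) q := by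
  induction j with
  | zero =>
    intro _ p i q
    simp only [List.take_zero, List.reverse_nil, List.map_nil, run]
    by_cases hq : q = .t1
    · subst hq
      rcases Nat.lt_or_ge i w.length with hi | hi
      · rw [List.drop_eq_getElem_cons hi]
        simp only [List.map_cons, List.head?_cons, Option.some.injEq, true_and]
        by_cases hc : p = .s2 ∧ dec w[i] = .b
        · obtain ⟨rfl, hb⟩ := hc
          have hs : Step (mach m) w ⟨.s2, i + 1, .t1, 0⟩ ⟨.fin, i + 1, .fin, 0⟩ := by
            refine mk_step false false ?_ ?_ rfl rfl
            · rw [tape_succ_lt hi, tape_zero]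
              simp [del1, mu2, D1_e, hb]
            · rw [tape_zero]; simp [del2]
          rw [accFrom_step hs, mk_halted2 (del2_fin _)]
          simp [hb]
        · rw [mk_halted1]
          · simp [hc]
          · rw [tape_succ_lt hi, tape_zero]
            simp [del1, mu2, D1_e, hc]
      · rw [List.drop_eq_nil_of_le hi]
        simp only [List.map_nil, List.head?_nil, reduceCtorEq, and_false, or_false]
        rw [mk_halted1]
        rw [tape_succ_ge hi]; rfl
    · simp only [hq, false_and, and_false, or_false]
      rw [mk_halted2]
      rw [tape_zero]; simp [del2, hq]
  | succ j ih =>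
    intro hj p i q
    have hj' : j < w.length := hj
    have e1 : (w.take (j + 1)).reverse = w[j] :: (w.take j).reverse := by
      rw [← List.take_append_getElem hj']; simp
    rw [e1]
    rcases Nat.lt_or_ge i w.length with hi | hi
    · rw [List.drop_eq_getElem_cons hi]
      simp only [List.map_cons, run]
      have f1 : del1 m p (tape w (i + 1)) (mu2 q (tape w (j + 1))) =
          D1 m p (dec w[i]) (out q (dec w[j])) := by
        rw [tape_succ_lt hi, tape_succ_lt hj']; rfl
      have f2 : del2 q (tape w (j + 1)) = (D2 q (dec w[j])).map fun q' => (q', true) := by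
        rw [tape_succ_lt hj']; rfl
      rcases h1 : D1 m p (dec w[i]) (out q (dec w[j])) with _ | ⟨p', k⟩
      · simp only
        exact mk_halted1 (f1.trans h1)
      · rcases h2 : D2 q (dec w[j]) with _ | q'
        · have : del2 q (tape w (j + 1)) = none := by rw [f2, h2]; rfl
          rw [mk_halted2 this]
          cases k <;> rfl
        · have f3 : del2 q (tape w (j + 1)) = some (q', true) := by rw [f2, h2]; rfl
          cases k
          · rw [accFrom_step (mk_step (p' := p') (q' := q') (i' := i + 1) (j' := j) false true
              (f1.trans h1) f3 rfl rfl), ih (by omega), List.drop_eq_getElem_cons hi]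
            simp only [List.map_cons]
          · rw [accFrom_step (mk_step (p' := p') (q' := q') (i' := i + 2) (j' := j) true true
              (f1.trans h1) f3 rfl rfl), ih (by omega)]
    · rw [List.drop_eq_nil_of_le hi]
      simp only [List.map_cons, List.map_nil, run]
      rw [mk_halted1]
      rw [tape_succ_ge hi]; rfl

theorem mem_lang_iff (m : Mode) (w : List (Fin 5)) :
    w ∈ lang (mach m) ↔ run m (w.map dec).reverse .s1 (w.map dec) .s1 := by
  have hs : Step (mach m) w (initConf (mach m) w) ⟨.s1, 0 + 1, .s1, w.length⟩ := by
    refine mk_step (p := .s1) (q := .s1) true true ?_ ?_ rfl rfl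
    · rw [tape_zero, tape_succ_ge le_rfl]; rfl
    · rw [tape_succ_ge le_rfl]; rfl
  change Accepts _ _ ↔ _
  rw [accepts_iff, accFrom_step hs, sim m w w.length le_rfl]
  simp

/-! ### Phase 1 -/

theorem run_fin (m : Mode) (l2 l1 : List Lt) (q : S2) : run m l2 .fin l1 q := by
  rcases l2 with _ | ⟨y, l2⟩
  · simp [run]
  · rcases l1 with _ | ⟨x, l1⟩
    · simp [run]
    · have : D1 m .fin x (out q y) = none := by simp [D1]
      simp [run, this]

theorem ph1 (m : Mode) (l2 : List Lt) : ∀ l1, run m l2 .s1 l1 .s1 →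
    ∃ x l1' l2', (∀ y ∈ x, y ≠ .c ∧ y ≠ .o) ∧ l1 = x ++ .c :: l1' ∧ l2 = x ++ .c :: l2' ∧
      (m ≠ .pal → run m l2' .wt (.c :: l1') .t0) := by
  induction l2 with
  | nil => intro l1 h; simp [run] at h
  | cons y l2 ih =>
    intro l1 h
    rcases l1 with _ | ⟨x, l1⟩
    · simp [run] at h
    · have hext : ∀ z : Lt, z ≠ .c ∧ z ≠ .o → x = z → y = z → run m l2 .s1 l1 .s1 →
        ∃ x' l1' l2', (∀ y ∈ x', y ≠ .c ∧ y ≠ .o) ∧ x :: l1 = x' ++ .c :: l1' ∧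
          y :: l2 = x' ++ .c :: l2' ∧ (m ≠ .pal → run m l2' .wt (.c :: l1') .t0) := by
        rintro z hz rfl rfl hr
        obtain ⟨x', l1', l2', h1, rfl, rfl, h4⟩ := ih l1 hr
        refine ⟨y :: x', l1', l2', ?_, rfl, rfl, h4⟩
        intro u hu
        rcases List.mem_cons.1 hu with rfl | hu
        · exact hz
        · exact h1 u hu
      cases y <;> cases x <;> simp [run, D1, D2, out] at h
      · exact hext .a (by simp) rfl rfl h
      · exact hext .b (by simp) rfl rfl h
      · exact hext .d (by simp) rfl rfl h
      · refine ⟨[], l1, l2, by simp, rfl, rfl, ?_⟩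
        intro hm
        simpa [hm] using h

theorem ph1' (m : Mode) (x l1 l2 : List Lt) (hx : ∀ y ∈ x, y ≠ .c ∧ y ≠ .o)
    (h : m = .pal ∨ run m l2 .wt (.c :: l1) .t0) :
    run m (x ++ .c :: l2) .s1 (x ++ .c :: l1) .s1 := by
  induction x with
  | nil =>
    by_cases hm : m = .pal
    · subst hm
      simp [run, D1, D2, out, run_fin]
    · simp only [hm, false_or] at h
      simpa [run, D1, D2, out, hm] using h
  | cons y x ih =>
    have ih' := ih fun z hz => hx z (List.mem_cons_of_mem _ hz)
    have hy := hx y List.mem_cons_self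
    cases y <;> simp [run, D1, D2, out] at hy ⊢ <;> exact (ih')

/-! ### Phase 2 -/

def Blk : S2 → List Lt → Prop
  | .t1, [] => True
  | q, .a :: l => Blk q l
  | .t0, .d :: l => Blk .t1 l
  | _, _ => False

def slow (m : Mode) : List Lt → ℕ
  | [] => 0
  | .a :: l => (if m = .lg then 1 else 0) + slow m l
  | _ :: l => 1 + slow m l

theorem wait (m : Mode) (l1 : List Lt) (l2 : List Lt) : ∀ q, q = .t0 ∨ q = .t1 →
    run m l2 .wt (.c :: l1) q →
    ∃ B l2', Blk q B ∧ l2 = B ++ .b :: l2' ∧ run m l2' .s2 l1 .t0 := by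
  induction l2 with
  | nil => intro q _ h; simp [run] at h
  | cons y l2 ih =>
    rintro q (rfl | rfl) h
    · cases y <;> simp [run, D1, D2, out] at h
      · obtain ⟨B, l2', h1, rfl, h3⟩ := ih _ (by simp) h
        exact ⟨.a :: B, l2', by simpa [Blk] using h1, rfl, h3⟩
      · obtain ⟨B, l2', h1, rfl, h3⟩ := ih _ (by simp) h
        exact ⟨.d :: B, l2', by simpa [Blk] using h1, rfl, h3⟩
    · cases y <;> simp [run, D1, D2, out] at h
      · obtain ⟨B, l2', h1, rfl, h3⟩ := ih _ (by simp) h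
        exact ⟨.a :: B, l2', by simpa [Blk] using h1, rfl, h3⟩
      · exact ⟨[], l2, by simp [Blk], rfl, h⟩

theorem wait' (m : Mode) (l1 l2 B : List Lt) : ∀ q, q = .t0 ∨ q = .t1 → Blk q B →
    run m l2 .s2 l1 .t0 → run m (B ++ .b :: l2) .wt (.c :: l1) q := by
  induction B with
  | nil =>
    rintro q (rfl | rfl) h hr
    · simp [Blk] at h
    · simpa [run, D1, D2, out] using hr
  | cons y B ih =>
    rintro q (rfl | rfl) h hr
    · cases y <;> simp [Blk] at h
      · simpa [run, D1, D2, out] using ih _ (by simp) h hr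
      · simpa [run, D1, D2, out] using ih _ (by simp) h hr
    · cases y <;> simp [Blk] at h
      · simpa [run, D1, D2, out] using ih _ (by simp) h hr

/-- one silent move of the lower component -/
theorem silent_s2 (m : Mode) (x : Lt) (l1 l2 : List Lt) (q : S2) (hq : q = .t0 ∨ q = .t1)
    (p p' : S1) (k : Bool) (hp : p ≠ .fin)
    (hp2 : p = .s2 → x ≠ .b)
    (hD : D1 m p x none = some (p', k)) (hb : D1 m p x (some .b2) = none)
    (h : run m l2 p (x :: l1) q) :
    ∃ y q' l2', l2 = y :: l2' ∧ (q' = .t0 ∨ q' = .t1) ∧ (∀ B, Blk q' B → Blk q (y :: B)) ∧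
      run m l2' p' (if k then l1 else x :: l1) q' := by
  rcases l2 with _ | ⟨y, l2⟩
  · simp only [run, List.head?_cons, Option.some.injEq] at h
    tauto
  · rcases hq with rfl | rfl <;> cases y <;> cases k <;>
      simp [run, D2, out, hD, hb, hp] at h
    all_goals exact ⟨_, _, l2, rfl, by simp, fun B hB => by simpa [Blk] using hB, h⟩

theorem silent_s2' (m : Mode) (x y : Lt) (l1 l2 B : List Lt) (q : S2) (hq : q = .t0 ∨ q = .t1)
    (p p' : S1) (k : Bool) (hD : D1 m p x none = some (p', k)) (hB : Blk q (y :: B)) :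
    ∃ q', (q' = .t0 ∨ q' = .t1) ∧ Blk q' B ∧
      (run m (y :: l2) p (x :: l1) q ↔ run m l2 p' (if k then l1 else x :: l1) q') := by
  rcases hq with rfl | rfl <;> cases y <;> simp [Blk] at hB <;> cases k <;>
    exact ⟨_, by simp, hB, by simp [run, D2, out, hD]⟩

theorem block (m : Mode) (r : List Lt) (B : List Lt) : ∀ (l2 : List Lt) (q : S2),
    q = .t0 ∨ q = .t1 → (∀ y ∈ B, y = .a ∨ y = .d) → run m l2 .s2 (B ++ .b :: r) q →
    ∃ B', Blk q B' ∧ B'.length = B.length + slow m B ∧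
      (l2 = B' ∨ ∃ l2', l2 = B' ++ .b :: l2' ∧ run m l2' .s2 r .t0) := by
  induction B with
  | nil =>
    intro l2 q hq _ h
    rcases l2 with _ | ⟨y, l2⟩
    · simp [run] at h
      subst h
      exact ⟨[], by simp [Blk], rfl, Or.inl rfl⟩
    · rcases hq with rfl | rfl <;> cases y <;> simp [run, D1, D2, out] at h
      exact ⟨[], by simp [Blk], rfl, Or.inr ⟨l2, rfl, h⟩⟩
  | cons x B ih =>
    intro l2 q hq hB h
    have hB' : ∀ y ∈ B, y = .a ∨ y = .d := fun y hy => hB y (List.mem_cons_of_mem _ hy)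
    have hslow : ∀ (hD : D1 m .s2 x none = some (.s3, false)) (hb : D1 m .s2 x (some .b2) = none)
        (hD' : D1 m .s3 x none = some (.s2, true)) (hb' : D1 m .s3 x (some .b2) = none)
        (hs : slow m (x :: B) = 1 + slow m B) (hx : x ≠ .b),
        ∃ B', Blk q B' ∧ B'.length = (x :: B).length + slow m (x :: B) ∧
        (l2 = B' ∨ ∃ l2', l2 = B' ++ .b :: l2' ∧ run m l2' .s2 r .t0) := by
      intro hD hb hD' hb' hs hx
      obtain ⟨y, q', l2, rfl, hq', hBl, h⟩ := silent_s2 m x _ l2 q hq _ _ _ (by simp)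
        (fun _ => hx) hD hb h
      obtain ⟨y', q'', l2, rfl, hq'', hBl', h⟩ := silent_s2 m x _ l2 q' hq' _ _ _ (by simp)
        (fun _ => hx) hD' hb' h
      obtain ⟨B', h1, h2, h3⟩ := ih l2 q'' hq'' hB' h
      refine ⟨y :: y' :: B', hBl _ (hBl' _ h1), ?_, ?_⟩
      · simp only [List.length_cons, h2, hs]; omega
      · rcases h3 with rfl | ⟨l2', rfl, h4⟩
        · exact Or.inl rfl
        · exact Or.inr ⟨l2', rfl, h4⟩
    rcases hB x List.mem_cons_self with rfl | rfl
    · by_cases hm : m = .lg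
      · subst hm
        exact hslow rfl rfl rfl rfl rfl (by simp)
      · obtain ⟨y, q', l2, rfl, hq', hBl, h⟩ := silent_s2 m .a _ l2 q hq .s2 .s2 true (by simp)
          (by simp) (by simp [D1, hm]) rfl h
        obtain ⟨B', h1, h2, h3⟩ := ih l2 q' hq' hB' h
        refine ⟨y :: B', hBl _ h1, ?_, ?_⟩
        · simp only [List.length_cons, h2, slow, hm, if_false]; omega
        · rcases h3 with rfl | ⟨l2', rfl, h4⟩
          · exact Or.inl rfl
          · exact Or.inr ⟨l2', rfl, h4⟩
    · exact hslow rfl rfl rfl rfl rfl (by simp)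

theorem block' (m : Mode) (r : List Lt) (B : List Lt) : ∀ (B' : List Lt) (q : S2),
    q = .t0 ∨ q = .t1 → (∀ y ∈ B, y = .a ∨ y = .d) → Blk q B' →
    B'.length = B.length + slow m B →
    run m B' .s2 (B ++ .b :: r) q ∧
    ∀ l2, run m l2 .s2 r .t0 → run m (B' ++ .b :: l2) .s2 (B ++ .b :: r) q := by
  induction B with
  | nil =>
    intro B' q hq _ h hl
    have : B' = [] := List.length_eq_zero_iff.1 (by simpa [slow] using hl)
    subst this
    rcases hq with rfl | rfl
    · simp [Blk] at h
    · exact ⟨by simp [run], fun l2 hr => by simpa [run, D1, D2, out] using hr⟩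
  | cons x B ih =>
    intro B' q hq hB h hl
    have hB' : ∀ y ∈ B, y = .a ∨ y = .d := fun y hy => hB y (List.mem_cons_of_mem _ hy)
    rcases B' with _ | ⟨y, B'⟩
    · simp only [List.length_cons, List.length_nil] at hl; omega
    have hslow : ∀ (hD : D1 m .s2 x none = some (.s3, false))
        (hD' : D1 m .s3 x none = some (.s2, true))
        (hs : slow m (x :: B) = 1 + slow m B),
        run m (y :: B') .s2 (x :: B ++ .b :: r) q ∧
        ∀ l2, run m l2 .s2 r .t0 → run m (y :: B' ++ .b :: l2) .s2 (x :: B ++ .b :: r) q := by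
      intro hD hD' hs
      rcases B' with _ | ⟨y', B'⟩
      · simp only [List.length_cons, hs, List.length_nil] at hl; omega
      simp only [List.length_cons, hs] at hl
      have key : ∀ l2, (∀ q'', (q'' = .t0 ∨ q'' = .t1) → Blk q'' B' →
          run m l2 .s2 (B ++ .b :: r) q'') → run m (y :: y' :: l2) .s2 (x :: B ++ .b :: r) q := by
        intro l2 hq2
        obtain ⟨q', hq', hb, hr⟩ := silent_s2' m x y (B ++ .b :: r) (y' :: l2) _ q hq _ _ _ hD h
        obtain ⟨q'', hq'', hb', hr'⟩ := silent_s2' m x y' (B ++ .b :: r) l2 _ q' hq' _ _ _ hD' hb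
        exact hr.2 (hr'.2 (hq2 q'' hq'' hb'))
      refine ⟨key _ fun q'' hq'' hb => (ih B' q'' hq'' hB' hb (by omega)).1, fun l2 hr => ?_⟩
      exact key _ fun q'' hq'' hb => (ih B' q'' hq'' hB' hb (by omega)).2 l2 hr
    rcases hB x List.mem_cons_self with rfl | rfl
    · by_cases hm : m = .lg
      · subst hm
        exact hslow rfl rfl rfl
      · have hD : D1 m .s2 .a none = some (.s2, true) := by simp [D1, hm]
        simp only [List.length_cons, slow, hm, if_false] at hl
        have key : ∀ l2, (∀ q'', (q'' = .t0 ∨ q'' = .t1) → Blk q'' B' →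
            run m l2 .s2 (B ++ .b :: r) q'') → run m (y :: l2) .s2 (.a :: B ++ .b :: r) q := by
          intro l2 hq2
          obtain ⟨q', hq', hb, hr⟩ := silent_s2' m .a y (B ++ .b :: r) l2 _ q hq _ _ _ hD h
          exact hr.2 (hq2 q' hq' hb)
        refine ⟨key _ fun q'' hq'' hb => (ih B' q'' hq'' hB' hb (by omega)).1, fun l2 hr => ?_⟩
        exact key _ fun q'' hq'' hb => (ih B' q'' hq'' hB' hb (by omega)).2 l2 hr
    · exact hslow rfl rfl rfl

end WK

namespace WK

theorem Blk_prop (B : List Lt) : ∀ q, Blk q B →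
    (∀ y ∈ B, y = .a ∨ y = .d) ∧ nonA B = (if q = .t0 then 1 else 0) ∧
    slow .sq B = (if q = .t0 then 1 else 0) ∧ nonA B ≤ B.length := by
  induction B with
  | nil => intro q h; cases q <;> simp [Blk, nonA, slow] at h ⊢
  | cons y B ih =>
    intro q h
    have key : ∀ q', Blk q' B → (y = .a ∧ q' = q) ∨ (y = .d ∧ q' = .t1 ∧ q = .t0) →
      (∀ z ∈ y :: B, z = .a ∨ z = .d) ∧ nonA (y :: B) = (if q = .t0 then 1 else 0) ∧
      slow .sq (y :: B) = (if q = .t0 then 1 else 0) ∧ nonA (y :: B) ≤ (y :: B).length := by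
      intro q' hq' hh
      obtain ⟨h1, h2, h3, h4⟩ := ih q' hq'
      unfold nonA at h2 h4 ⊢
      rcases hh with ⟨rfl, rfl⟩ | ⟨rfl, rfl, rfl⟩
      · refine ⟨?_, ?_, ?_, ?_⟩
        · simpa using h1
        · simpa using h2
        · simpa [slow] using h3
        · simp at h4 ⊢; omega
      · refine ⟨?_, ?_, ?_, ?_⟩
        · simpa using h1
        · simpa using h2
        · simpa [slow] using h3
        · simp at h4 ⊢; omega
    cases q <;> cases y <;> simp only [Blk] at h
    all_goals exact key _ h (by simp)

theorem slow_lg (B : List Lt) : slow .lg B = B.length := by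
  induction B with
  | nil => rfl
  | cons y B ih => cases y <;> simp [slow, ih] <;> omega

theorem nonA_append (l l' : List Lt) : nonA (l ++ l') = nonA l + nonA l' := by
  simp [nonA]

theorem nonA_cons (y : Lt) (l : List Lt) (h : y ≠ .a) : nonA (y :: l) = 1 + nonA l := by
  simp [nonA, h]

theorem nonA_le (l : List Lt) : nonA l ≤ l.length := by
  induction l with
  | nil => simp [nonA]
  | cons y l ih => unfold nonA at *; simp only [List.map_cons, List.sum_cons, List.length_cons]; split_ifs <;> omega

theorem nonA_reverse (l : List Lt) : nonA l.reverse = nonA l := by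
  simp [nonA, List.sum_reverse]

theorem Blk_pos {B : List Lt} (h : Blk .t0 B) : 1 ≤ B.length := by
  have := (Blk_prop B _ h).2
  simp at this
  omega

theorem Blk_c {B : List Lt} (h : Blk .t0 B) : Lt.c ∉ B := by
  intro hc
  have := (Blk_prop B _ h).1 _ hc
  simp at this

/-- Growth of the blocks in an accepting phase 2. -/
theorem growth (m : Mode) (P : ℕ → ℕ → ℕ → Prop)
    (hP1 : ∀ B, Blk .t0 B → P B.length 1 (B.length + slow m B))
    (hP2 : ∀ B k n, Blk .t0 B → P (B.length + slow m B) k n →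
      P B.length (k + 1) (B.length + slow m B + 1 + n)) :
    ∀ (N : ℕ) (l2 B : List Lt), l2.length ≤ N → Blk .t0 B → run m l2 .s2 (B ++ .b :: l2) .t0 →
    .c ∉ l2 ∧ ∃ k, nonA l2 ≤ 2 * k ∧ P B.length k l2.length := by
  intro N
  induction N with
  | zero =>
    intro l2 B hl hB h
    have : l2 = [] := List.length_eq_zero_iff.1 (by omega)
    subst this
    simp [run] at h
  | succ N ih =>
    intro l2 B hl hB h
    obtain ⟨B', h1, h2, h3⟩ := block m l2 B l2 .t0 (Or.inl rfl) (Blk_prop B _ hB).1 h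
    have hn := (Blk_prop B' _ h1).2.1
    simp only [if_true] at hn
    rcases h3 with rfl | ⟨l2', rfl, h4⟩
    · refine ⟨Blk_c h1, 1, by omega, ?_⟩
      rw [h2]; exact hP1 B hB
    · have hl' : l2'.length ≤ N := by
        simp only [List.length_append, List.length_cons] at hl; omega
      obtain ⟨hc, k, hk, hp⟩ := ih l2' B' hl' h1 h4
      refine ⟨?_, k + 1, ?_, ?_⟩
      · simp only [List.mem_append, List.mem_cons, not_or]
        exact ⟨Blk_c h1, by simp, hc⟩
      · rw [nonA_append, nonA_cons _ _ (by simp)]; omega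
      · rw [h2] at hp
        have := hP2 B k _ hB hp
        simp only [List.length_append, List.length_cons, h2]
        convert this using 1
        omega

theorem no_c (m : Mode) (l2 : List Lt) : ∀ (p : S1) (l1 : List Lt) (q : S2), q = .t0 ∨ q = .t1 →
    p ≠ .fin → run m l2 p l1 q → .c ∉ l2 := by
  induction l2 with
  | nil => simp
  | cons y l2 ih =>
    intro p l1 q hq hp h
    rcases l1 with _ | ⟨x, l1⟩
    · exact absurd h hp
    · have hy : y ≠ .c := by
        rintro rfl
        rcases hq with rfl | rfl
        · rcases hd : D1 m p x none with _ | ⟨p', _ | _⟩ <;> simp [run, out, D2, hd, hp] at h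
        · rcases hd : D1 m p x none with _ | ⟨p', _ | _⟩ <;> simp [run, out, D2, hd, hp] at h
      simp only [List.mem_cons, not_or]
      refine ⟨fun h => hy h.symm, ?_⟩
      rcases hd2 : D2 q y with _ | q'
      · rcases hd : D1 m p x (out q y) with _ | ⟨p', _ | _⟩ <;> simp [run, hd2, hd, hp] at h
      have hq' : q' = .t0 ∨ q' = .t1 := by
        rcases hq with rfl | rfl <;> cases y <;> simp [D2] at hd2 <;> simp [← hd2]
      have ho : out q y = none ∨ out q y = some .b2 := by
        rcases hq with rfl | rfl <;> cases y <;> simp [out]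
      rcases hd : D1 m p x (out q y) with _ | ⟨p', k⟩
      · simp [run, hd2, hd, hp] at h
      have hp' : p' ≠ .fin := by
        rintro rfl
        rcases ho with ho | ho <;> rw [ho] at hd <;> cases m <;> cases p <;> cases x <;>
          simp [D1] at hd
      cases k
      · exact ih p' (x :: l1) q' hq' hp' (by simpa [run, hd, hd2] using h)
      · exact ih p' l1 q' hq' hp' (by simpa [run, hd, hd2] using h)

theorem accepted_bound (m : Mode) (hm : m ≠ .pal) (P : ℕ → ℕ → ℕ → Prop)
    (hP1 : ∀ B, Blk .t0 B → P B.length 1 (B.length + slow m B))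
    (hP2 : ∀ B k n, Blk .t0 B → P (B.length + slow m B) k n →
      P B.length (k + 1) (B.length + slow m B + 1 + n))
    (w : List (Fin 5)) (hw : w ∈ lang (mach m)) :
    ∃ g k n, 1 ≤ g ∧ P g k n ∧ nonA (w.map dec) ≤ 4 * k + 5 ∧ w.length = 2 * (g + 1 + n) + 1 := by
  rw [mem_lang_iff] at hw
  have hlen : w.length = (w.map dec).length := by simp
  rw [hlen]
  generalize w.map dec = v at hw
  obtain ⟨x, l1, l2, hx, h1, h2, h3⟩ := ph1 m _ _ hw
  have h4 := h3 hm
  obtain ⟨B, l2', hB, h5, h6⟩ := wait m l1 l2 .t0 (Or.inl rfl) h4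
  have hcx : Lt.c ∉ x := fun h => (hx _ h).1 rfl
  have hcl : Lt.c ∉ l2 := no_c m l2 _ _ _ (Or.inl rfl) (by simp) h4
  have hrev : v = l2.reverse ++ .c :: x.reverse := by
    have := congrArg List.reverse h2
    simpa using this
  have hsplit := (List.append_cons_inj_of_notMem (by simpa using hcl) (by simpa using hcx)).1
    (hrev.symm.trans h1)
  have hl : l1 = l2 := by
    rw [← hsplit.2.2, ← hsplit.1, List.reverse_reverse]
  rw [hl, h5] at h6
  obtain ⟨-, k, hk, hp⟩ := growth m P hP1 hP2 _ l2' B le_rfl hB h6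
  have hn := (Blk_prop B _ hB).2.1
  simp only [if_true] at hn
  refine ⟨B.length, k, l2'.length, Blk_pos hB, hp, ?_, ?_⟩
  · rw [h1, ← hsplit.1, hl, nonA_append, nonA_cons _ _ (by simp), nonA_reverse, h5, nonA_append,
      nonA_cons _ _ (by simp)]
    omega
  · rw [h1, ← hsplit.1, hl, h5]
    simp
    omega

theorem pal_mem : RevCommBounded (mach .pal) (fun n => 3 * n + 3) := by
  apply mach_bounded
  intro w _
  have := nonA_le (w.map dec)
  simp only [List.length_map] at this
  omega

theorem lg_mem : RevCommBounded (mach .lg) (fun n => 8 * Nat.log 2 n + 8) := by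
  apply mach_bounded
  intro w hw
  obtain ⟨g, k, n, hg, hp, h1, h2⟩ := accepted_bound .lg (by simp)
    (fun g k n => g * 2 ^ (k + 1) ≤ n + 2 * g)
    (by
      intro B _
      rw [slow_lg]
      omega)
    (by
      intro B k n _ h
      simp only [slow_lg] at h ⊢
      have e : (B.length + B.length) * 2 ^ (k + 1) = B.length * 2 ^ (k + 1 + 1) := by
        rw [pow_succ 2 (k + 1)]; ring
      omega) w hw
  have h3 : 2 ^ (k + 1) ≤ w.length := by
    obtain ⟨g, rfl⟩ := Nat.exists_eq_add_of_le hg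
    have h4 : 2 ≤ 2 ^ (k + 1) := by
      rw [pow_succ]; have := Nat.one_le_two_pow (n := k); omega
    have h5 : g * 2 ≤ g * 2 ^ (k + 1) := Nat.mul_le_mul_left _ h4
    have h6 : (1 + g) * 2 ^ (k + 1) = 2 ^ (k + 1) + g * 2 ^ (k + 1) := by ring
    omega
  have := Nat.le_log_of_pow_le (by norm_num) h3
  omega

theorem sq_mem : RevCommBounded (mach .sq) (fun n => 8 * Nat.sqrt n + 8) := by
  apply mach_bounded
  intro w hw
  obtain ⟨g, k, n, hg, hp, h1, h2⟩ := accepted_bound .sq (by simp)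
    (fun g k n => 2 * k * g + k * (k + 1) ≤ 2 * n)
    (by
      intro B hB
      have := (Blk_prop B _ hB).2.2.1
      simp only [if_true] at this
      omega)
    (by
      intro B k n hB h
      have := (Blk_prop B _ hB).2.2.1
      simp only [if_true] at this
      simp only [this] at h ⊢
      nlinarith) w hw
  have h3 : k * k ≤ w.length := by nlinarith
  have := Nat.le_sqrt.2 h3
  omega

/-! ### Fooling words -/

/-- A block with its data marker at position `r`. -/
def blk (g r : ℕ) : List Lt := List.replicate r .a ++ .d :: List.replicate (g - 1 - r) .a

def wrd (g : ℕ → ℕ) (r : ℕ → ℕ) : ℕ → ℕ → List Lt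
  | i, 0 => blk (g i) (r i)
  | i, n + 1 => blk (g i) (r i) ++ .b :: wrd g r (i + 1) n

theorem blk_length {g r : ℕ} (h : r < g) : (blk g r).length = g := by
  simp [blk]; omega

theorem Blk_rep (q : S2) (n : ℕ) (l : List Lt) :
    Blk q (List.replicate n .a ++ l) ↔ Blk q l := by
  induction n with
  | zero => simp
  | succ n ih => rw [List.replicate_succ, List.cons_append]; cases q <;> simpa [Blk] using ih

theorem Blk_blk (g r : ℕ) : Blk .t0 (blk g r) := by
  unfold blk
  rw [Blk_rep]
  have := Blk_rep .t1 (g - 1 - r) []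
  rw [List.append_nil] at this
  simp [Blk, this]

theorem blk_inj {g r r' : ℕ} (h : blk g r = blk g r') : r = r' := by
  have hd : ∀ n, Lt.d ∉ List.replicate n Lt.a := by
    intro n hn
    have := List.eq_of_mem_replicate hn
    simp at this
  have := (List.append_cons_inj_of_notMem (hd _) (hd _)).1 h
  simpa using congrArg List.length this.1

theorem wrd_length {g r : ℕ → ℕ} (h : ∀ i, r i < g i) (n : ℕ) : ∀ i,
    (wrd g r i n).length = n + ∑ j ∈ Finset.range (n + 1), g (i + j) := by
  induction n with
  | zero => intro i; simp [wrd, blk_length (h i)]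
  | succ n ih =>
    intro i
    rw [Finset.sum_range_succ']
    simp only [wrd, List.length_append, List.length_cons, ih, blk_length (h i), add_zero]
    have : ∀ j, g (i + 1 + j) = g (i + (j + 1)) := fun j => by congr 1; ring
    simp only [this]
    ring

theorem wrd_inj {g r r' : ℕ → ℕ} (h : ∀ i, r i < g i) (h' : ∀ i, r' i < g i) (n : ℕ) : ∀ i,
    wrd g r i n = wrd g r' i n → ∀ j ≤ n, r (i + j) = r' (i + j) := by
  induction n with
  | zero =>
    intro i hi j hj
    obtain rfl : j = 0 := by omega
    exact blk_inj hi
  | succ n ih =>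
    intro i hi j hj
    simp only [wrd] at hi
    have := List.append_inj hi (by rw [blk_length (h i), blk_length (h' i)])
    rcases j with _ | j
    · exact blk_inj this.1
    · have h2 := ih (i + 1) (List.cons.inj this.2).2 j (by omega)
      rw [show i + (j + 1) = i + 1 + j by ring]
      exact h2

theorem wrd_letters (g r : ℕ → ℕ) (n : ℕ) : ∀ i, ∀ y ∈ wrd g r i n, y ≠ .c ∧ y ≠ .o := by
  have hb : ∀ g r, ∀ y ∈ blk g r, y ≠ .c ∧ y ≠ .o := by
    intro g r y hy
    have := (Blk_prop _ _ (Blk_blk g r)).1 y hy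
    rcases this with rfl | rfl <;> simp
  induction n with
  | zero => intro i; exact hb _ _
  | succ n ih =>
    intro i y hy
    simp only [wrd, List.mem_append, List.mem_cons] at hy
    rcases hy with hy | rfl | hy
    · exact hb _ _ y hy
    · simp
    · exact ih _ y hy

theorem wrd_run (m : Mode) {g r : ℕ → ℕ} (h : ∀ i, r i < g i)
    (hg : ∀ i, g (i + 1) = g i + slow m (blk (g i) (r i))) (n : ℕ) : ∀ i,
    run m (wrd g r (i + 1) n) .s2 (blk (g i) (r i) ++ .b :: wrd g r (i + 1) n) .t0 := by
  induction n with
  | zero =>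
    intro i
    refine (block' m _ _ _ .t0 (Or.inl rfl) (Blk_prop _ _ (Blk_blk _ _)).1 (Blk_blk _ _) ?_).1
    rw [blk_length (h _), blk_length (h _), hg]
  | succ n ih =>
    intro i
    refine (block' m _ _ _ .t0 (Or.inl rfl) (Blk_prop _ _ (Blk_blk _ _)).1 (Blk_blk _ _) ?_).2 _
      (ih (i + 1))
    rw [blk_length (h _), blk_length (h _), hg]

theorem wrd_acc (m : Mode) {g r : ℕ → ℕ} (h : ∀ i, r i < g i)
    (hg : ∀ i, g (i + 1) = g i + slow m (blk (g i) (r i))) (n : ℕ) :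
    run m (wrd g r 0 (n + 1)) .wt (.c :: wrd g r 0 (n + 1)) .t0 := by
  exact wait' m _ _ _ .t0 (Or.inl rfl) (Blk_blk _ _) (wrd_run m h hg n 0)

/-- left and right halves of fooling words -/
def UU (z : List Lt) : List (Fin 5) := (z.reverse ++ [Lt.c]).map enc

def VV (z : List Lt) : List (Fin 5) := z.map enc

theorem map_dec_enc (z : List Lt) : (z.map enc).map dec = z := by
  rw [List.map_map]
  convert List.map_id z
  funext x
  exact dec_enc x

theorem fool_mem (m : Mode) (z : List Lt) (hz : ∀ y ∈ z, y ≠ .c ∧ y ≠ .o)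
    (h : m = .pal ∨ run m z .wt (.c :: z) .t0) : UU z ++ VV z ∈ lang (mach m) := by
  rw [mem_lang_iff]
  have : (UU z ++ VV z).map dec = z.reverse ++ .c :: z := by
    rw [UU, VV, ← List.map_append, map_dec_enc]; simp
  rw [this]
  have e : (z.reverse ++ .c :: z).reverse = z.reverse ++ .c :: z := by simp
  rw [e]
  exact ph1' m _ _ _ (by simpa using hz) h

theorem fool_eq (m : Mode) (z z' : List Lt) (hz : ∀ y ∈ z, y ≠ .c ∧ y ≠ .o)
    (hz' : ∀ y ∈ z', y ≠ .c ∧ y ≠ .o)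
    (h : UU z ++ VV z' ∈ lang (mach m)) : z = z' := by
  rw [mem_lang_iff] at h
  have : (UU z ++ VV z').map dec = z.reverse ++ .c :: z' := by
    rw [UU, VV, ← List.map_append, map_dec_enc]; simp
  rw [this] at h
  obtain ⟨x, l1, l2, hx, h1, h2, -⟩ := ph1 m _ _ h
  have hc : Lt.c ∉ z := fun h => (hz _ h).1 rfl
  have hc' : Lt.c ∉ z' := fun h => (hz' _ h).1 rfl
  have e1 := (List.append_cons_inj_of_notMem (by simpa using hc) (by simpa using hc')).1 h1
  have h2' : z'.reverse ++ .c :: z = x ++ .c :: l2 := by simpa using h2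
  have e2 := (List.append_cons_inj_of_notMem (by simpa using hc') (by simpa using hc)).1 h2'
  exact List.reverse_injective (e1.1.trans e2.1.symm)

end WK

namespace WK

section Lower
variable {α : Type} {A : DPWK α} {w : List α}

/-- Move of the upper component. -/
def Mv1 (A : DPWK α) (w : List α) (p : A.Q1) (i : ℕ) (x : Option A.M) (p' : A.Q1) (i' : ℕ) : Prop :=
  ∃ d : Bool, A.δ1 p (tape w i) x = some (p', d) ∧ i' = i + cond d 1 0

/-- Move of the lower component. -/
def Mv2 (A : DPWK α) (w : List α) (q : A.Q2) (j : ℕ) (x : Option A.M) (q' : A.Q2) (j' : ℕ) : Prop :=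
  ∃ d : Bool, A.δ2 q (tape w j) x = some (q', d) ∧ j = j' + cond d 1 0

/-- Message of the upper component. -/
def ms1 (A : DPWK α) (w : List α) (c : Config A) : Option A.M := A.μ1 c.p (tape w c.i)

/-- Message of the lower component. -/
def ms2 (A : DPWK α) (w : List α) (c : Config A) : Option A.M := A.μ2 c.q (tape w c.j)

/-- The upper component can move. -/
def Can1 (A : DPWK α) (w : List α) (c : Config A) : Prop :=
  ∃ p2 i2, Mv1 A w c.p c.i (ms2 A w c) p2 i2

/-- The lower component can move. -/
def Can2 (A : DPWK α) (w : List α) (c : Config A) : Prop :=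
  ∃ q' j', Mv2 A w c.q c.j (ms1 A w c) q' j'

theorem step_iff_mv {c c' : Config A} : Step A w c c' ↔
    Mv1 A w c.p c.i (ms2 A w c) c'.p c'.i ∧ Mv2 A w c.q c.j (ms1 A w c) c'.q c'.j := by
  constructor
  · rintro ⟨d1, d2, h1, h2, h3, h4⟩
    exact ⟨⟨d1, h1, h3⟩, ⟨d2, h2, h4⟩⟩
  · rintro ⟨⟨d1, h1, h3⟩, ⟨d2, h2, h4⟩⟩
    exact ⟨d1, d2, h1, h2, h3, h4⟩

theorem halted_iff_can {c : Config A} : Halted A w c ↔ ¬ (Can1 A w c ∧ Can2 A w c) := by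
  unfold Halted
  rw [not_iff_not]
  constructor
  · rintro ⟨c', h⟩
    rw [step_iff_mv] at h
    exact ⟨⟨_, _, h.1⟩, ⟨_, _, h.2⟩⟩
  · rintro ⟨⟨p, i, h1⟩, ⟨q, j, h2⟩⟩
    exact ⟨⟨p, i, q, j⟩, step_iff_mv.2 ⟨h1, h2⟩⟩

/-- An accepting run of length `T` indexed by time. -/
structure IsRun (A : DPWK α) (w : List α) (T : ℕ) (c : ℕ → Config A) : Prop where
  init : c 0 = initConf A w
  step : ∀ t < T, Step A w (c t) (c (t + 1))
  halt : Halted A w (c T)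
  acc : AccConf A (c T)

theorem IsRun.mem {T : ℕ} {c : ℕ → Config A} (h : IsRun A w T c) : w ∈ lang A := by
  show Accepts A w
  rw [accepts_iff]
  refine ⟨c T, ?_, h.halt, h.acc⟩
  rw [← h.init]
  have : ∀ t ≤ T, Relation.ReflTransGen (Step A w) (c 0) (c t) := by
    intro t
    induction t with
    | zero => intro _; exact .refl
    | succ t ih => intro ht; exact (ih (by omega)).tail (h.step t (by omega))
  exact this T le_rfl

theorem exists_run {cs : List (Config A)} (h : AccComp A w cs) :
    ∃ T c, IsRun A w T c ∧
      ∑ t ∈ Finset.range T, stepMsgs A A.μ1 A.μ2 w (c t) = commCount A A.μ1 A.μ2 w cs := by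
  obtain ⟨h1, h2, x, h3, h4, h5⟩ := h
  have hne : cs ≠ [] := by rintro rfl; simp at h1
  have hpos : 0 < cs.length := List.length_pos_iff.2 hne
  refine ⟨cs.length - 1, fun t => cs.getD t x, ⟨?_, ?_, ?_, ?_⟩, ?_⟩
  · rw [List.head?_eq_getElem?] at h1
    simp [List.getD, h1]
  · intro t ht
    have := (List.isChain_iff_getElem.1 h2) t (by omega)
    simpa [List.getD, List.getElem?_eq_getElem (show t < cs.length by omega),
      List.getElem?_eq_getElem (show t + 1 < cs.length by omega)] using this
  · rw [List.getLast?_eq_getElem?] at h3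
    simpa [List.getD, h3] using h4
  · rw [List.getLast?_eq_getElem?] at h3
    simpa [List.getD, h3] using h5
  · unfold commCount
    rw [Finset.sum_range, ← List.sum_ofFn]
    congr 1
    apply List.ext_getElem
    · simp
    · intro k hk hk'
      simp at hk hk'
      simp [List.getD, List.getElem?_eq_getElem (show k < cs.length by omega)]

theorem tape_min (i : ℕ) : tape w (min i (w.length + 1)) = tape w i := by
  rcases le_total i (w.length + 1) with h | h
  · rw [min_eq_left h]
  · rw [min_eq_right h]
    obtain ⟨k, rfl⟩ : ∃ k, i = k + 1 := ⟨i - 1, by omega⟩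
    rw [tape_succ_ge le_rfl, tape_succ_ge (by omega)]

/-- Essential part of a configuration. -/
def key (w : List α) (c : Config A) : A.Q1 × ℕ × A.Q2 × ℕ :=
  (c.p, min c.i (w.length + 1), c.q, c.j)

theorem key_step {c c' d d' : Config A} (h : key w c = key w c')
    (h1 : Step A w c d) (h2 : Step A w c' d') : key w d = key w d' := by
  obtain ⟨p, i, q, j⟩ := c
  obtain ⟨p', i', q', j'⟩ := c'
  simp only [key, Prod.mk.injEq] at h
  obtain ⟨rfl, hi, rfl, rfl⟩ := h
  have ht : tape w i = tape w i' := by rw [← tape_min i, hi, tape_min]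
  obtain ⟨a1, a2, h3, h4, h5, h6⟩ := h1
  obtain ⟨b1, b2, k3, k4, k5, k6⟩ := h2
  simp only at *
  rw [← ht, h3] at k3
  rw [← ht, h4] at k4
  simp only [Option.some.injEq, Prod.mk.injEq] at k3 k4
  obtain ⟨k3, rfl⟩ := k3
  obtain ⟨k4, rfl⟩ := k4
  simp only [key, Prod.mk.injEq]
  refine ⟨k3, ?_, k4, by omega⟩
  omega

theorem key_halted {c c' : Config A} (h : key w c = key w c') (hh : Halted A w c') :
    Halted A w c := by
  rintro ⟨d, a1, a2, h3, h4, h5, h6⟩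
  apply hh
  obtain ⟨p, i, q, j⟩ := c
  obtain ⟨p', i', q', j'⟩ := c'
  simp only [key, Prod.mk.injEq] at h
  obtain ⟨rfl, hi, rfl, rfl⟩ := h
  have ht : tape w i = tape w i' := by rw [← tape_min i, hi, tape_min]
  simp only at *
  rw [ht] at h3 h4
  exact ⟨⟨d.p, i' + cond a1 1 0, d.q, d.j⟩, a1, a2, h3, h4, rfl, h6⟩

theorem IsRun.j_le {T : ℕ} {c : ℕ → Config A} (h : IsRun A w T c) :
    ∀ t ≤ T, (c t).j ≤ w.length + 1 := by
  intro t
  induction t with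
  | zero => intro _; rw [h.init]; simp [initConf]
  | succ t ih =>
    intro ht
    obtain ⟨_, _, _, _, _, h6⟩ := h.step t (by omega)
    have := ih (by omega)
    omega

theorem IsRun.key_ne {T : ℕ} {c : ℕ → Config A} (h : IsRun A w T c) {a b : ℕ} (hab : a < b)
    (hb : b ≤ T) : key w (c a) ≠ key w (c b) := by
  intro he
  have : ∀ k, b + k ≤ T → key w (c (a + k)) = key w (c (b + k)) := by
    intro k
    induction k with
    | zero => intro _; exact he
    | succ k ih =>
      intro hk
      exact key_step (ih (by omega)) (h.step (a + k) (by omega)) (h.step (b + k) (by omega))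
  have h2 := this (T - b) (by omega)
  rw [show b + (T - b) = T by omega] at h2
  exact key_halted h2 h.halt ⟨_, h.step (a + (T - b)) (by omega)⟩

theorem IsRun.T_lt {T : ℕ} {c : ℕ → Config A} (h : IsRun A w T c) :
    letI := A.fQ1; letI := A.fQ2
    T + 1 ≤ Fintype.card A.Q1 * Fintype.card A.Q2 * (w.length + 2) ^ 2 := by
  letI := A.fQ1
  letI := A.fQ2
  have hinj : Function.Injective (fun t : Fin (T + 1) =>
      (((c t).p, (⟨min (c t).i (w.length + 1), by omega⟩ : Fin (w.length + 2))),
        ((c t).q, (⟨(c t).j, by have := h.j_le t (by omega); omega⟩ : Fin (w.length + 2))))) := by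
    intro a b hab
    simp only [Prod.mk.injEq, Fin.mk.injEq] at hab
    obtain ⟨⟨h1, h2⟩, h3, h4⟩ := hab
    have hk : key w (c a) = key w (c b) := by simp only [key, h1, h2, h3, h4]
    rcases lt_trichotomy a b with hl | hl | hl
    · exact absurd hk (h.key_ne hl (by omega))
    · exact hl
    · exact absurd hk.symm (h.key_ne hl (by omega))
  have := Fintype.card_le_of_injective _ hinj
  simp only [Fintype.card_fin, Fintype.card_prod] at this
  calc T + 1 ≤ _ := this
    _ = _ := by ring

theorem tape_left {u v v' : List α} (i : ℕ) (h : i ≤ u.length) :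
    tape (u ++ v) i = tape (u ++ v') i := by
  rcases i with _ | i
  · rw [tape_zero, tape_zero]
  · rw [tape_succ_lt (by simp; omega), tape_succ_lt (by simp; omega)]
    rw [List.getElem_append_left (by omega), List.getElem_append_left (by omega)]

theorem tape_right {u u' v : List α} (hu : u.length = u'.length) (i : ℕ) (h : u.length < i) :
    tape (u ++ v) i = tape (u' ++ v) i := by
  rcases i with _ | i
  · omega
  · rcases Nat.lt_or_ge i (u ++ v).length with hi | hi
    · rw [tape_succ_lt hi, tape_succ_lt (by simp at hi ⊢; omega)]
      rw [List.getElem_append_right (by omega), List.getElem_append_right (by omega)]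
      simp [hu]
    · rw [tape_succ_ge hi, tape_succ_ge (by simp at hi ⊢; omega)]

end Lower

end WK

namespace WK

section Mix
variable {α : Type} {A : DPWK α}

/-- The mixed configuration. -/
def mixC (m : ℕ) (c c' : Config A) : Config A :=
  ⟨if c.i ≤ m then c.p else c'.p, if c.i ≤ m then c.i else c'.i,
   if m < c.j then c'.q else c.q, if m < c.j then c'.j else c.j⟩

theorem mv1_congr {w w' : List α} {p p' : A.Q1} {i i' : ℕ} {x : Option A.M}
    (h : tape w i = tape w' i) : Mv1 A w p i x p' i' ↔ Mv1 A w' p i x p' i' := by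
  simp only [Mv1, h]

theorem mv2_congr {w w' : List α} {p p' : A.Q2} {i i' : ℕ} {x : Option A.M}
    (h : tape w i = tape w' i) : Mv2 A w p i x p' i' ↔ Mv2 A w' p i x p' i' := by
  simp only [Mv2, h]

variable {u v u' v' : List α}

theorem mix_ms1 {c c' : Config A} (hu : u.length = u'.length)
    (hi : c.i ≤ u.length ↔ c'.i ≤ u.length)
    (h1 : ms1 A (u ++ v) c = ms1 A (u' ++ v') c') :
    ms1 A (u ++ v') (mixC u.length c c') = ms1 A (u ++ v) c := by
  by_cases h : c.i ≤ u.length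
  · simp only [ms1, mixC, h, if_true]
    rw [tape_left (v := v') (v' := v) _ h]
  · rw [h1]
    simp only [ms1, mixC, h, if_false]
    rw [tape_right hu _ (by omega)]

theorem mix_ms2 {c c' : Config A} (hu : u.length = u'.length)
    (hj : u.length < c.j ↔ u.length < c'.j)
    (h1 : ms2 A (u ++ v) c = ms2 A (u' ++ v') c') :
    ms2 A (u ++ v') (mixC u.length c c') = ms2 A (u ++ v) c := by
  by_cases h : u.length < c.j
  · rw [h1]
    simp only [ms2, mixC, h, if_true]
    rw [tape_right hu _ (by omega)]
  · simp only [ms2, mixC, h, if_false]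
    rw [tape_left (v := v') (v' := v) _ (by omega)]

theorem mix_run (hu : u.length = u'.length) (hv : v.length = v'.length) {T : ℕ}
    {c c' : ℕ → Config A} (hc : IsRun A (u ++ v) T c) (hc' : IsRun A (u' ++ v') T c')
    (hi : ∀ t ≤ T, (c t).i ≤ u.length ↔ (c' t).i ≤ u.length)
    (hj : ∀ t ≤ T, u.length < (c t).j ↔ u.length < (c' t).j)
    (hp : ∀ t < T, (c t).i ≤ u.length → u.length < (c (t + 1)).i → (c (t + 1)).p = (c' (t + 1)).p)
    (hq : ∀ t < T, u.length < (c t).j → (c (t + 1)).j ≤ u.length → (c (t + 1)).q = (c' (t + 1)).q)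
    (h1 : ∀ t ≤ T, ms1 A (u ++ v) (c t) = ms1 A (u' ++ v') (c' t))
    (h2 : ∀ t ≤ T, ms2 A (u ++ v) (c t) = ms2 A (u' ++ v') (c' t))
    (g1 : Can1 A (u ++ v) (c T) ↔ Can1 A (u' ++ v') (c' T))
    (g2 : Can2 A (u ++ v) (c T) ↔ Can2 A (u' ++ v') (c' T))
    (f1 : (c T).p ∈ A.F1 ↔ (c' T).p ∈ A.F1) (f2 : (c T).q ∈ A.F2 ↔ (c' T).q ∈ A.F2) :
    IsRun A (u ++ v') T (fun t => mixC u.length (c t) (c' t)) := by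
  have m1 : ∀ t ≤ T, ms1 A (u ++ v') (mixC u.length (c t) (c' t)) = ms1 A (u ++ v) (c t) :=
    fun t ht => mix_ms1 hu (hi t ht) (h1 t ht)
  have m2 : ∀ t ≤ T, ms2 A (u ++ v') (mixC u.length (c t) (c' t)) = ms2 A (u ++ v) (c t) :=
    fun t ht => mix_ms2 hu (hj t ht) (h2 t ht)
  refine ⟨?_, ?_, ?_, ?_⟩
  · simp only [hc.init, hc'.init, mixC, initConf]
    simp [hu]
  · intro t ht
    have s := step_iff_mv.1 (hc.step t ht)
    have s' := step_iff_mv.1 (hc'.step t ht)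
    have a0 := hi t (by omega)
    have a1 := hi (t + 1) (by omega)
    have b0 := hj t (by omega)
    have b1 := hj (t + 1) (by omega)
    rw [step_iff_mv, m1 t ht.le, m2 t ht.le]
    constructor
    · by_cases h : (c t).i ≤ u.length
      · have key : Mv1 A (u ++ v') (c t).p (c t).i (ms2 A (u ++ v) (c t)) (c (t + 1)).p (c (t + 1)).i :=
          (mv1_congr (tape_left _ h)).1 s.1
        by_cases h' : (c (t + 1)).i ≤ u.length
        · simpa only [mixC, h, h', if_true] using key
        · have e1 := hp t ht h (by omega)
          have e2 : (c (t + 1)).i = (c' (t + 1)).i := by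
            obtain ⟨d, _, hd⟩ := s.1
            obtain ⟨d', _, hd'⟩ := s'.1
            cases d <;> cases d' <;> simp only [cond_true, cond_false] at hd hd' <;> omega
          rw [e1, e2] at key
          simpa only [mixC, h, h', if_true, if_false] using key
      · have h' : ¬ (c (t + 1)).i ≤ u.length := by
          obtain ⟨d, _, hd⟩ := s.1
          omega
        have key : Mv1 A (u ++ v') (c' t).p (c' t).i (ms2 A (u' ++ v') (c' t)) (c' (t + 1)).p (c' (t + 1)).i :=
          (mv1_congr (tape_right hu.symm _ (by omega))).1 s'.1
        rw [h2 t ht.le]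
        simpa only [mixC, h, h', if_false] using key
    · by_cases h : u.length < (c t).j
      · have key : Mv2 A (u ++ v') (c' t).q (c' t).j (ms1 A (u' ++ v') (c' t)) (c' (t + 1)).q (c' (t + 1)).j :=
          (mv2_congr (tape_right hu.symm _ (by omega))).1 s'.2
        rw [h1 t ht.le]
        by_cases h' : u.length < (c (t + 1)).j
        · simpa only [mixC, h, h', if_true] using key
        · have e1 := hq t ht h (by omega)
          have e2 : (c (t + 1)).j = (c' (t + 1)).j := by
            obtain ⟨d, _, hd⟩ := s.2
            obtain ⟨d', _, hd'⟩ := s'.2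
            cases d <;> cases d' <;> simp only [cond_true, cond_false] at hd hd' <;> omega
          rw [← e1, ← e2] at key
          simpa only [mixC, h, h', if_true, if_false] using key
      · have h' : ¬ u.length < (c (t + 1)).j := by
          obtain ⟨d, _, hd⟩ := s.2
          omega
        have key : Mv2 A (u ++ v') (c t).q (c t).j (ms1 A (u ++ v) (c t)) (c (t + 1)).q (c (t + 1)).j :=
          (mv2_congr (tape_left _ (by omega))).1 s.2
        simpa only [mixC, h, h', if_false] using key
  · have hh := hc.halt
    rw [halted_iff_can] at hh ⊢
    rintro ⟨k1, k2⟩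
    apply hh
    have a0 := hi T le_rfl
    have b0 := hj T le_rfl
    constructor
    · obtain ⟨p', i', k⟩ := k1
      rw [m2 T le_rfl] at k
      by_cases h : (c T).i ≤ u.length
      · simp only [mixC, h, if_true] at k
        exact ⟨p', i', (mv1_congr (tape_left _ h)).1 k⟩
      · rw [g1]
        simp only [mixC, h, if_false] at k
        rw [h2 T le_rfl] at k
        exact ⟨p', i', (mv1_congr (tape_right hu _ (by omega))).1 k⟩
    · obtain ⟨q', j', k⟩ := k2
      rw [m1 T le_rfl] at k
      by_cases h : u.length < (c T).j
      · rw [g2]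
        simp only [mixC, h, if_true] at k
        rw [h1 T le_rfl] at k
        exact ⟨q', j', (mv2_congr (tape_right hu _ (by omega))).1 k⟩
      · simp only [mixC, h, if_false] at k
        exact ⟨q', j', (mv2_congr (tape_left _ (by omega))).1 k⟩
  · have ha := hc.acc
    unfold AccConf at ha ⊢
    rcases ha with ha | ha
    · left
      simp only [mixC]
      split_ifs
      · exact ha
      · exact f1.1 ha
    · right
      simp only [mixC]
      split_ifs
      · exact f2.1 ha
      · exact ha

theorem IsRun.i_mono {w : List α} {T : ℕ} {c : ℕ → Config A} (h : IsRun A w T c) :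
    ∀ s t, s ≤ t → t ≤ T → (c s).i ≤ (c t).i := by
  intro s t hst
  induction t, hst using Nat.le_induction with
  | base => intro _; exact le_rfl
  | succ t _ ih =>
    intro ht
    obtain ⟨_, _, _, _, h5, _⟩ := h.step t (by omega)
    have := ih (by omega)
    omega

theorem IsRun.j_anti {w : List α} {T : ℕ} {c : ℕ → Config A} (h : IsRun A w T c) :
    ∀ s t, s ≤ t → t ≤ T → (c t).j ≤ (c s).j := by
  intro s t hst
  induction t, hst using Nat.le_induction with
  | base => intro _; exact le_rfl
  | succ t _ ih =>
    intro ht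
    obtain ⟨_, _, _, _, _, h5⟩ := h.step t (by omega)
    have := ih (by omega)
    omega

/-- Threshold time of a monotone predicate. -/
theorem exists_threshold (T : ℕ) (P : ℕ → Prop) (hP : ∀ s t, s ≤ t → t ≤ T → P t → P s) :
    ∃ k ≤ T + 1, ∀ t ≤ T, P t ↔ t < k := by
  classical
  by_cases h : ∃ k, k ≤ T ∧ ¬ P k
  · refine ⟨Nat.find h, by have := (Nat.find_spec h).1; omega, fun t ht => ⟨fun hp => ?_, fun hl => ?_⟩⟩
    · by_contra hn
      exact (Nat.find_spec h).2 (hP _ _ (by omega) ht hp)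
    · by_contra hn
      exact Nat.find_min h hl ⟨ht, hn⟩
  · push Not at h
    exact ⟨T + 1, le_rfl, fun t ht => ⟨fun _ => by omega, fun _ => h t ht⟩⟩

/-- Encoding of sparse functions. -/
theorem exists_code {β : Type} (z : β) (T N f : ℕ) (hN : T < N) (h : ℕ → β)
    (S : Finset ℕ) (hS : ∀ t ≤ T, h t ≠ z → t ∈ S) (hT : ∀ t ∈ S, t ≤ T) (hc : S.card ≤ f) :
    ∃ code : Fin f → Fin N × β, ∀ t ≤ T, ∀ x, x ≠ z → (h t = x ↔ ∃ i, (code i).1 = t ∧ (code i).2 = x) := by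
  have hτ : ∀ i : Fin f, S.toList.getD i 0 ≤ T := by
    intro i
    rw [List.getD_eq_getElem?_getD]
    rcases hh : S.toList[(i : ℕ)]? with _ | y
    · simp
    · exact hT y (Finset.mem_toList.1 (List.mem_of_getElem? hh))
  refine ⟨fun i => (⟨S.toList.getD i 0, by have := hτ i; omega⟩, h (S.toList.getD i 0)), ?_⟩
  intro t ht x hx
  constructor
  · rintro rfl
    have hm := Finset.mem_toList.2 (hS t ht hx)
    obtain ⟨k, hk, he⟩ := List.getElem_of_mem hm
    have hk' : k < f := by rw [Finset.length_toList] at hk; omega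
    refine ⟨⟨k, hk'⟩, ?_⟩
    simp [List.getD, List.getElem?_eq_getElem hk, he]
  · rintro ⟨i, h1, h2⟩
    simp only at h1 h2
    rw [h1] at h2
    exact h2

end Mix

end WK

namespace WK

section Fool
variable {α : Type}

/-- Codes of accepting runs. -/
structure Code (A : DPWK α) (N f : ℕ) where
  T : Fin N
  k1 : Fin N
  k2 : Fin N
  p : A.Q1
  q : A.Q2
  b : (Bool × Bool) × (Bool × Bool)
  code : Fin f → Fin N × (Option A.M × Option A.M)

/-- `x` is a code of an accepting run on `w`, cut at `m`. -/
def Good (A : DPWK α) (N f m : ℕ) (w : List α) (x : Code A N f) : Prop :=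
  ∃ c : ℕ → Config A, IsRun A w x.T c ∧
    (∀ t ≤ (x.T : ℕ), (c t).i ≤ m ↔ t < x.k1) ∧ (∀ t ≤ (x.T : ℕ), m < (c t).j ↔ t < x.k2) ∧
    (c x.k1).p = x.p ∧ (c x.k2).q = x.q ∧
    (Can1 A w (c x.T) ↔ x.b.1.1 = true) ∧ (Can2 A w (c x.T) ↔ x.b.1.2 = true) ∧
    ((c x.T).p ∈ A.F1 ↔ x.b.2.1 = true) ∧ ((c x.T).q ∈ A.F2 ↔ x.b.2.2 = true) ∧
    ∀ t ≤ (x.T : ℕ), ∀ y, y ≠ (none, none) →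
      ((ms1 A w (c t), ms2 A w (c t)) = y ↔ ∃ i, (x.code i).1 = t ∧ (x.code i).2 = y)

theorem exists_good (A : DPWK α) (N f m : ℕ) (w : List α)
    (hN : letI := A.fQ1; letI := A.fQ2
      Fintype.card A.Q1 * Fintype.card A.Q2 * (w.length + 2) ^ 2 < N)
    (h : ∃ cs, AccComp A w cs ∧ commCount A A.μ1 A.μ2 w cs ≤ f) :
    ∃ x : Code A N (f + 1), Good A N (f + 1) m w x := by
  classical
  obtain ⟨cs, hcs, hf⟩ := h
  obtain ⟨T, c, hc, hsum⟩ := exists_run hcs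
  have hT := hc.T_lt
  obtain ⟨k1, hk1, hk1'⟩ := exists_threshold T (fun t => (c t).i ≤ m)
    (fun s t hst ht h => (hc.i_mono s t hst ht).trans h)
  obtain ⟨k2, hk2, hk2'⟩ := exists_threshold T (fun t => m < (c t).j)
    (fun s t hst ht h => lt_of_lt_of_le h (hc.j_anti s t hst ht))
  have hcard : ((Finset.range (T + 1)).filter
      (fun t => (ms1 A w (c t), ms2 A w (c t)) ≠ (none, none))).card ≤ f + 1 := by
    rw [Finset.card_filter, Finset.sum_range_succ]
    apply Nat.add_le_add
    · refine le_trans (Finset.sum_le_sum ?_) (hsum.le.trans hf)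
      intro t _
      unfold stepMsgs ms1 ms2
      rcases A.μ1 (c t).p (tape w (c t).i) with _ | a <;>
        rcases A.μ2 (c t).q (tape w (c t).j) with _ | b <;> simp
    · split_ifs <;> simp
  obtain ⟨code, hcode⟩ := exists_code (none, none) T N (f + 1) (by omega)
    (fun t => (ms1 A w (c t), ms2 A w (c t)))
    ((Finset.range (T + 1)).filter (fun t => (ms1 A w (c t), ms2 A w (c t)) ≠ (none, none)))
    (by intro t ht h; simp only [Finset.mem_filter, Finset.mem_range]; exact ⟨by omega, h⟩)
    (by intro t ht; simp only [Finset.mem_filter, Finset.mem_range] at ht; omega) hcard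
  refine ⟨⟨⟨T, by omega⟩, ⟨k1, by omega⟩, ⟨k2, by omega⟩, (c k1).p, (c k2).q,
    ((decide (Can1 A w (c T)), decide (Can2 A w (c T))),
      (decide ((c T).p ∈ A.F1), decide ((c T).q ∈ A.F2))), code⟩, c, hc, hk1', hk2', rfl, rfl, ?_, ?_,
      ?_, ?_, hcode⟩ <;> simp

theorem good_mix {A : DPWK α} {N f m : ℕ} {u v u' v' : List α} {x : Code A N f}
    (hu : u.length = m) (hu' : u'.length = m) (hv : v.length = v'.length)
    (h : Good A N f m (u ++ v) x) (h' : Good A N f m (u' ++ v') x) : u ++ v' ∈ lang A := by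
  obtain ⟨c, hc, a1, a2, a3, a4, a5, a6, a7, a8, a9⟩ := h
  obtain ⟨c', hc', b1, b2, b3, b4, b5, b6, b7, b8, b9⟩ := h'
  subst hu
  have hm : ∀ t ≤ (x.T : ℕ), (ms1 A (u ++ v) (c t), ms2 A (u ++ v) (c t)) =
      (ms1 A (u' ++ v') (c' t), ms2 A (u' ++ v') (c' t)) := by
    intro t ht
    by_cases hz : (ms1 A (u ++ v) (c t), ms2 A (u ++ v) (c t)) = (none, none)
    · by_cases hz' : (ms1 A (u' ++ v') (c' t), ms2 A (u' ++ v') (c' t)) = (none, none)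
      · rw [hz, hz']
      · exact (a9 t ht _ hz').2 ((b9 t ht _ hz').1 rfl)
    · exact ((b9 t ht _ hz).2 ((a9 t ht _ hz).1 rfl)).symm
  refine (mix_run hu'.symm hv hc hc' (fun t ht => (a1 t ht).trans (b1 t ht).symm)
    (fun t ht => (a2 t ht).trans (b2 t ht).symm) ?_ ?_ (fun t ht => congrArg Prod.fst (hm t ht))
    (fun t ht => congrArg Prod.snd (hm t ht)) (a5.trans b5.symm) (a6.trans b6.symm)
    (a7.trans b7.symm) (a8.trans b8.symm)).mem
  · intro t ht h1 h2
    have e1 := a1 t (by omega)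
    have e2 := a1 (t + 1) (by omega)
    have : (x.k1 : ℕ) = t + 1 := by omega
    rw [← this, a3, b3]
  · intro t ht h1 h2
    have e1 := a2 t (by omega)
    have e2 := a2 (t + 1) (by omega)
    have : (x.k2 : ℕ) = t + 1 := by omega
    rw [← this, a4, b4]

/-- Codes as a product type. -/
def codeEquiv (A : DPWK α) (N f : ℕ) : Code A N f →
    (((Fin N × Fin N) × Fin N) × ((A.Q1 × A.Q2) × ((Bool × Bool) × (Bool × Bool)))) ×
      (Fin f → Fin N × (Option A.M × Option A.M)) :=
  fun x => ((((x.T, x.k1), x.k2), ((x.p, x.q), x.b)), x.code)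

theorem codeEquiv_inj (A : DPWK α) (N f : ℕ) : Function.Injective (codeEquiv A N f) := by
  intro x y h
  cases x; cases y
  simp only [codeEquiv, Prod.mk.injEq] at h
  obtain ⟨⟨⟨⟨rfl, rfl⟩, rfl⟩, ⟨rfl, rfl⟩, rfl⟩, rfl⟩ := h
  rfl

theorem fooling (A : DPWK α) : ∃ D : ℕ, 1 ≤ D ∧ ∀ (ι : Type) [Fintype ι] (m l f : ℕ) (U V : ι → List α),
    (∀ s, (U s).length = m) → (∀ s, (V s).length = l) →
    (∀ s, ∃ cs, AccComp A (U s ++ V s) cs ∧ commCount A A.μ1 A.μ2 (U s ++ V s) cs ≤ f) →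
    (∀ s t, U s ++ V t ∈ lang A → s = t) →
    Fintype.card ι ≤ (D * (m + l + 2) ^ 2) ^ (f + 5) := by
  letI := A.fQ1
  letI := A.fQ2
  letI := A.fM
  refine ⟨32 * (Fintype.card A.Q1 * Fintype.card A.Q2 + 1) * (Fintype.card A.M + 1) ^ 2,
    Nat.mul_pos (by omega) (by positivity), ?_⟩
  intro ι _ m l f U V hU hV hacc hfool
  set N := Fintype.card A.Q1 * Fintype.card A.Q2 * (m + l + 2) ^ 2 + 1 with hN
  have hg : ∀ s, ∃ x : Code A N (f + 1), Good A N (f + 1) m (U s ++ V s) x := by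
    intro s
    apply exists_good A N f m (U s ++ V s) _ (hacc s)
    simp only [List.length_append, hU, hV]
    omega
  choose x hx using hg
  have hinj : Function.Injective (fun s => codeEquiv A N (f + 1) (x s)) := by
    intro s t hst
    have hst := codeEquiv_inj _ _ _ hst
    apply hfool
    have h2 := hx t
    rw [← hst] at h2
    exact good_mix (hU s) (hU t) ((hV s).trans (hV t).symm) (hx s) h2
  have hcard := Fintype.card_le_of_injective _ hinj
  simp only [Fintype.card_prod, Fintype.card_fin, Fintype.card_bool, Fintype.card_fun,
    Fintype.card_option] at hcard
  refine hcard.trans ?_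
  set Q := Fintype.card A.Q1 * Fintype.card A.Q2
  set R := Fintype.card A.M + 1
  set Y := (m + l + 2) ^ 2
  have hY : 1 ≤ Y := Nat.one_le_pow _ _ (by omega)
  have hR : 1 ≤ R ^ 2 := Nat.one_le_pow _ _ (by omega)
  have hNY : N ≤ (Q + 1) * Y := by rw [hN]; nlinarith
  have e3 : N * (R * R) ≤ 32 * (Q + 1) * R ^ 2 * Y := by
    calc N * (R * R) ≤ (Q + 1) * Y * (R * R) := Nat.mul_le_mul_right _ hNY
      _ = 1 * ((Q + 1) * Y * R ^ 2) := by ring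
      _ ≤ 32 * ((Q + 1) * Y * R ^ 2) := Nat.mul_le_mul_right _ (by omega)
      _ = _ := by ring
  have e1 : N ≤ 32 * (Q + 1) * R ^ 2 * Y := by
    refine le_trans ?_ e3
    calc N = N * 1 := by ring
      _ ≤ N * (R * R) := Nat.mul_le_mul_left _ (by rw [← pow_two]; exact hR)
  have e2 : Q * (2 * 2 * (2 * 2)) ≤ 32 * (Q + 1) * R ^ 2 * Y := by
    calc Q * (2 * 2 * (2 * 2)) ≤ 32 * (Q + 1) * 1 * 1 := by omega
      _ ≤ _ := Nat.mul_le_mul (Nat.mul_le_mul_left _ hR) hY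
  generalize 32 * (Q + 1) * R ^ 2 * Y = X at e1 e2 e3 ⊢
  calc _ ≤ X * X * X * X * X ^ (f + 1) := by gcongr
    _ = X ^ (f + 5) := by ring

end Fool

end WK

namespace WK

theorem langsO_mono {α : Type} {f g : ℕ → ℕ} (B : ℕ) (h : ∀ n, f n ≤ B * g n + B) :
    RevPWKLangsO α f ⊆ RevPWKLangsO α g := by
  rintro L ⟨A, C, ⟨W, hW⟩, rfl⟩
  refine ⟨A, C * B + C, ⟨W, ?_⟩, rfl⟩
  have hb : ∀ n, C * f n + C ≤ (C * B + C) * g n + (C * B + C) := by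
    intro n
    have := Nat.mul_le_mul_left C (h n)
    nlinarith
  intro w hw
  obtain ⟨cs, h1, h2, h3⟩ := hW w hw
  exact ⟨cs, h1, h2.trans (hb _), h3.trans (hb _)⟩

theorem log_le_sqrt (n : ℕ) : Nat.log 2 n ≤ 2 * Nat.sqrt n + 2 := by
  rcases Nat.eq_zero_or_pos n with rfl | hn
  · simp
  have h1 : n < 2 ^ (2 * Nat.sqrt n) := by
    have h2 : Nat.sqrt n + 1 ≤ 2 ^ Nat.sqrt n := Nat.lt_two_pow_self
    calc n < (Nat.sqrt n + 1) * (Nat.sqrt n + 1) := Nat.lt_succ_sqrt n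
      _ ≤ 2 ^ Nat.sqrt n * 2 ^ Nat.sqrt n := Nat.mul_le_mul h2 h2
      _ = _ := by rw [two_mul, pow_add]
  have := Nat.log_lt_of_lt_pow (by omega) h1
  omega

theorem lower (m : Mode) (f : ℕ → ℕ) (hmem : lang (mach m) ∈ RevPWKLangsO (Fin 5) f) :
    ∃ C D : ℕ, ∀ (ι : Type) [Fintype ι] (L : ℕ) (Z : ι → List Lt), Function.Injective Z →
      (∀ s, (Z s).length = L) → (∀ s, ∀ y ∈ Z s, y ≠ .c ∧ y ≠ .o) →
      (∀ s, m = .pal ∨ run m (Z s) .wt (.c :: Z s) .t0) →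
      Fintype.card ι ≤ (D * (2 * L + 3) ^ 2) ^ (C * f (2 * L + 1) + C + 5) := by
  obtain ⟨A, C, ⟨W, hW⟩, hA⟩ := hmem
  obtain ⟨D, -, hD⟩ := fooling A
  refine ⟨C, D, ?_⟩
  intro ι _ L Z hinj hlen hlet hacc
  have hU : ∀ s, (UU (Z s)).length = L + 1 := by intro s; simp [UU, hlen]
  have hV : ∀ s, (VV (Z s)).length = L := by intro s; simp [VV, hlen]
  have := hD ι (L + 1) L (C * f (2 * L + 1) + C) (fun s => UU (Z s)) (fun s => VV (Z s)) hU hV ?_ ?_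
  · rw [show L + 1 + L + 2 = 2 * L + 3 by ring] at this
    exact this
  · intro s
    have hm := fool_mem m (Z s) (hlet s) (hacc s)
    rw [← hA] at hm
    obtain ⟨cs, h1, h2, -⟩ := hW _ hm
    rw [List.length_append, hU, hV, show L + 1 + L = 2 * L + 1 by ring] at h2
    exact ⟨cs, h1, h2⟩
  · intro s t h
    rw [hA] at h
    exact hinj (fool_eq m _ _ (hlet s) (hlet t) h)

theorem lower_blocks (m : Mode) (f : ℕ → ℕ) (hmem : lang (mach m) ∈ RevPWKLangsO (Fin 5) f)
    (g : ℕ → ℕ) (hpos : ∀ i, 0 < g i)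
    (hg : ∀ i r, r < g i → g (i + 1) = g i + slow m (blk (g i) r)) :
    ∃ C D : ℕ, ∀ K L : ℕ, L = K + 1 + ∑ j ∈ Finset.range (K + 2), g j →
      ∏ j ∈ Finset.range (K + 2), g j ≤ (D * (2 * L + 3) ^ 2) ^ (C * f (2 * L + 1) + C + 5) := by
  obtain ⟨C, D, h⟩ := lower m f hmem
  refine ⟨C, D, ?_⟩
  intro K L hL
  set R : ((j : Fin (K + 2)) → Fin (g j)) → ℕ → ℕ := fun s i =>
    if hi : i < K + 2 then (s ⟨i, hi⟩ : ℕ) else 0 with hR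
  have hlt : ∀ s i, R s i < g i := by
    intro s i
    simp only [hR]
    split_ifs with hi
    · exact (s ⟨i, hi⟩).2
    · exact hpos i
  have := h ((j : Fin (K + 2)) → Fin (g j)) L (fun s => wrd g (R s) 0 (K + 1)) ?_ ?_ ?_ ?_
  · rw [Fintype.card_pi] at this
    simp only [Fintype.card_fin] at this
    rwa [Finset.prod_range]
  · intro s t hst
    have e := wrd_inj (hlt s) (hlt t) (K + 1) 0 hst
    funext j
    have e1 := e j (by omega)
    simp only [hR, zero_add, j.2, dif_pos] at e1
    exact Fin.ext e1
  · intro s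
    rw [wrd_length (hlt s), hL]
    simp
  · intro s
    exact wrd_letters _ _ _ _
  · intro s
    right
    exact wrd_acc m (hlt s) (fun i => hg i _ (hlt s i)) K

theorem exists_big (A : ℕ) : ∃ j, A * (j + 1) ^ 2 < 2 ^ j := by
  refine ⟨4 * (25 * A + 1), ?_⟩
  set n := 25 * A + 1 with hn
  have h1 : n < 2 ^ n := Nat.lt_two_pow_self
  have h2 : n ^ 4 < (2 ^ n) ^ 4 := Nat.pow_lt_pow_left h1 (by norm_num)
  rw [← pow_mul, mul_comm n 4] at h2
  refine lt_of_le_of_lt ?_ h2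
  have hn1 : 1 ≤ n := by omega
  calc A * (4 * n + 1) ^ 2 ≤ A * (5 * n) ^ 2 := by gcongr; omega
    _ = 25 * A * n ^ 2 := by ring
    _ ≤ n * n ^ 2 := by gcongr; omega
    _ = n ^ 3 * 1 := by ring
    _ ≤ n ^ 3 * n := by gcongr
    _ = n ^ 4 := by ring

theorem base_le (D L e : ℕ) (h : 2 * L + 3 ≤ 2 ^ e) : D * (2 * L + 3) ^ 2 ≤ 2 ^ (D + 2 * e) := by
  calc D * (2 * L + 3) ^ 2 ≤ 2 ^ D * (2 ^ e) ^ 2 := by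
        gcongr
        exact Nat.lt_two_pow_self.le
    _ = _ := by rw [← pow_mul, ← pow_add, mul_comm e 2]

theorem exp_le {P D L e a b F : ℕ} (h : 2 * L + 3 ≤ 2 ^ e) (hP : 2 ^ a ≤ P)
    (hPX : P ≤ (D * (2 * L + 3) ^ 2) ^ F) (hF : F ≤ b) : a ≤ (D + 2 * e) * b := by
  have h1 : 2 ^ a ≤ 2 ^ ((D + 2 * e) * F) := by
    calc 2 ^ a ≤ _ := hP.trans hPX
      _ ≤ (2 ^ (D + 2 * e)) ^ F := Nat.pow_le_pow_left (base_le D L e h) F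
      _ = _ := by rw [← pow_mul]
  exact ((Nat.pow_le_pow_iff_right (by norm_num)).1 h1).trans (Nat.mul_le_mul_left _ hF)

theorem pal_not : lang (mach .pal) ∉ RevPWKLangsO (Fin 5) Nat.sqrt := by
  intro hmem
  obtain ⟨C, D, h⟩ := lower _ _ hmem
  obtain ⟨j, hj⟩ := exists_big ((D + 6) * (3 * C + 5))
  have h4 : (4 : ℕ) ^ j = 2 ^ j * 2 ^ j := by rw [← mul_pow]; norm_num
  have hp := Nat.one_le_two_pow (n := j)
  have hc := h (Fin (4 ^ j) → Bool) (4 ^ j)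
    (fun s => List.ofFn (fun i => if s i then Lt.a else Lt.b)) ?_ ?_ ?_ ?_
  · simp only [Fintype.card_fun, Fintype.card_bool, Fintype.card_fin] at hc
    have hs : Nat.sqrt (2 * 4 ^ j + 1) ≤ 2 * 2 ^ j := by
      apply Nat.lt_succ_iff.1
      apply Nat.sqrt_lt.2
      rw [h4]
      nlinarith
    have hL : 2 * 4 ^ j + 3 ≤ 2 ^ (2 * j + 3) := by
      rw [pow_add, pow_mul]
      have : 1 ≤ 4 ^ j := Nat.one_le_pow _ _ (by norm_num)
      norm_num
      omega
    have e := exp_le (b := (3 * C + 5) * 2 ^ j) hL le_rfl hc (by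
      have := Nat.mul_le_mul_left C hs
      nlinarith)
    have e2 : 2 ^ j * 2 ^ j ≤ ((D + 2 * (2 * j + 3)) * (3 * C + 5)) * 2 ^ j := by
      rw [← h4]; refine e.trans (le_of_eq ?_); ring
    have e3 := Nat.le_of_mul_le_mul_right e2 (by omega)
    have e4 : (D + 2 * (2 * j + 3)) * (3 * C + 5) ≤ (D + 6) * (3 * C + 5) * (j + 1) ^ 2 := by
      have : D + 2 * (2 * j + 3) ≤ (D + 6) * (j + 1) ^ 2 := by nlinarith [Nat.zero_le (D * j), Nat.zero_le (D * j * j)]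
      calc _ ≤ (D + 6) * (j + 1) ^ 2 * (3 * C + 5) := Nat.mul_le_mul_right _ this
        _ = _ := by ring
    omega
  · intro s t hst
    have := List.ofFn_injective hst
    funext i
    have hi := congrFun this i
    rcases hs : s i <;> rcases ht : t i <;> simp [hs, ht] at hi ⊢
  · intro s; simp
  · intro s y hy
    rw [List.mem_ofFn] at hy
    obtain ⟨i, rfl⟩ := hy
    split_ifs <;> simp
  · intro s; left; rfl

theorem sq_not : lang (mach .sq) ∉ RevPWKLangsO (Fin 5) (fun n => Nat.log 2 n) := by
  intro hmem
  obtain ⟨C, D, h⟩ := lower_blocks _ _ hmem (fun i => i + 1) (fun i => by omega) (by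
    intro i r _
    have := (Blk_prop _ _ (Blk_blk (i + 1) r)).2.2.1
    simp only [if_true] at this
    rw [this])
  obtain ⟨j, hj⟩ := exists_big ((D + 6) * (4 * C + 5) + 1)
  have hp := Nat.one_le_two_pow (n := j)
  have hj1 : 2 ≤ 2 ^ j := by
    have : 1 ≤ (j + 1) ^ 2 := Nat.one_le_pow _ _ (by omega)
    have : ((D + 6) * (4 * C + 5) + 1) * 1 ≤ ((D + 6) * (4 * C + 5) + 1) * (j + 1) ^ 2 :=
      Nat.mul_le_mul_left _ this
    omega
  obtain ⟨K, hK⟩ : ∃ K, K + 2 = 2 ^ j := ⟨2 ^ j - 2, by omega⟩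
  have h4 : (4 : ℕ) ^ j = 2 ^ j * 2 ^ j := by rw [← mul_pow]; norm_num
  obtain ⟨L, hL⟩ : ∃ L, L = K + 1 + ∑ j ∈ Finset.range (K + 2), (j + 1) := ⟨_, rfl⟩
  have hc := h K L hL
  have hL2 : L ≤ 2 * 4 ^ j := by
    have : ∑ j ∈ Finset.range (K + 2), (j + 1) ≤ (K + 2) * (K + 2) := by
      refine (Finset.sum_le_card_nsmul _ _ (K + 2) ?_).trans ?_
      · intro x hx; rw [Finset.mem_range] at hx; omega
      · simp
    rw [h4, ← hK]
    nlinarith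
  have h1 : 1 ≤ 4 ^ j := Nat.one_le_pow _ _ (by norm_num)
  have h8 : 2 ^ (2 * j + 3) = 8 * 4 ^ j := by
    rw [pow_add, pow_mul]; norm_num; ring
  have hL3 : 2 * L + 3 ≤ 2 ^ (2 * j + 3) := by omega
  have hlog : Nat.log 2 (2 * L + 1) ≤ 2 * j + 3 :=
    (Nat.log_lt_of_lt_pow (by omega) (by omega)).le
  have hprod : 2 ^ (K + 1) ≤ ∏ j ∈ Finset.range (K + 2), (j + 1) := by
    rw [Finset.prod_range_succ']
    simp only [zero_add, mul_one]
    rw [← Finset.card_range (K + 1), ← Finset.prod_const, Finset.card_range]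
    apply Finset.prod_le_prod'
    intro i _
    omega
  have e := exp_le (b := (4 * C + 5) * (j + 1)) hL3 hprod hc (by
    have := Nat.mul_le_mul_left C hlog
    nlinarith)
  have e4 : (D + 2 * (2 * j + 3)) * ((4 * C + 5) * (j + 1)) ≤ (D + 6) * (4 * C + 5) * (j + 1) ^ 2 := by
    have : D + 2 * (2 * j + 3) ≤ (D + 6) * (j + 1) := by nlinarith [Nat.zero_le (D * j)]
    calc _ ≤ (D + 6) * (j + 1) * ((4 * C + 5) * (j + 1)) := Nat.mul_le_mul_right _ this
      _ = _ := by ring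
  have e5 : 1 ≤ (j + 1) ^ 2 := Nat.one_le_pow _ _ (by omega)
  rw [add_mul] at hj
  omega

theorem lg_not : lang (mach .lg) ∉ RevPWKLangsO (Fin 5) (fun _ => 1) := by
  intro hmem
  obtain ⟨C, D, h⟩ := lower_blocks _ _ hmem (fun i => 2 ^ i) (fun i => by positivity) (by
    intro i r hr
    rw [slow_lg, blk_length hr, pow_succ]
    ring)
  set E := (D + 8) * (2 * C + 5) with hE
  obtain ⟨K, hK⟩ : ∃ K, K + 2 = 2 * E + 2 := ⟨2 * E, rfl⟩
  obtain ⟨L, hL⟩ : ∃ L, L = K + 1 + ∑ j ∈ Finset.range (K + 2), 2 ^ j := ⟨_, rfl⟩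
  have hc := h K L hL
  set k := K + 2 with hk
  have hgeo : ∑ j ∈ Finset.range k, 2 ^ j < 2 ^ k := Nat.geomSum_lt (by norm_num) (by simp)
  have hkk : k < 2 ^ k := Nat.lt_two_pow_self
  have hL3 : 2 * L + 3 ≤ 2 ^ (k + 3) := by
    rw [pow_add]; omega
  have hprod : 2 ^ (∑ i ∈ Finset.range k, i) ≤ ∏ j ∈ Finset.range k, 2 ^ j := by
    rw [Finset.prod_pow_eq_pow_sum]
  have e := exp_le (b := 2 * C + 5) hL3 hprod hc (by omega)
  have hs := Finset.sum_range_id_mul_two k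
  have e2 : (D + 2 * (k + 3)) * (2 * C + 5) ≤ E * k := by
    have : D + 2 * (k + 3) ≤ (D + 8) * k := by
      have : D * 1 ≤ D * k := Nat.mul_le_mul_left _ (by omega)
      nlinarith
    calc _ ≤ (D + 8) * k * (2 * C + 5) := Nat.mul_le_mul_right _ this
      _ = _ := by rw [hE]; ring
  have e3 : k * (k - 1) ≤ k * (2 * E) := by
    rw [← hs]
    calc _ ≤ E * k * 2 := Nat.mul_le_mul_right _ (e.trans e2)
      _ = _ := by ring
  have e4 := Nat.le_of_mul_le_mul_left e3 (by omega)
  omega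

end WK

open WK in
/-- Over a (sufficiently large, here five-letter) alphabet, the
language classes of reversible two-party Watson-Crick systems with communication
bounds `O(1)`, `O(log n)`, `O(√n)` and `O(n)` form a strictly increasing hierarchy. -/
theorem REV_PWK_communication_hierarchy :
    RevPWKLangsO (Fin 5) (fun _ => 1) ⊂ RevPWKLangsO (Fin 5) (fun n => Nat.log 2 n) ∧
    RevPWKLangsO (Fin 5) (fun n => Nat.log 2 n) ⊂ RevPWKLangsO (Fin 5) Nat.sqrt ∧
    RevPWKLangsO (Fin 5) Nat.sqrt ⊂ RevPWKLangsO (Fin 5) (fun n => n) := by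
  refine ⟨⟨?_, ?_⟩, ⟨?_, ?_⟩, ⟨?_, ?_⟩⟩
  · exact langsO_mono 1 (fun n => by omega)
  · intro h
    exact lg_not (h ⟨mach .lg, 8, lg_mem, rfl⟩)
  · exact langsO_mono 2 log_le_sqrt
  · intro h
    exact sq_not (h ⟨mach .sq, 8, sq_mem, rfl⟩)
  · exact langsO_mono 1 (fun n => by have := Nat.sqrt_le_self n; omega)
  · intro h
    exact pal_not (h ⟨mach .pal, 3, pal_mem, rfl⟩)
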